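/- Let η ∈ (1/2, 1] and A > 1 be constants. For each prime q choose a positive integer h_q such that h_q → ∞ and (log h_q)/(log log q) → 0 as q → ∞ through primes. Then there exists an η-strong set B of primes such that for every λ ∈ ℝ, M_{g,q,h_q}(λ) with g(q) = (log q)^A converges to (1/√(2π))·∫_{-∞}^{λ} e^{-t²/2} dt as q → ∞ along q ∈ B. -/

import Mathlib

open Filter Topology MeasureTheory
open scoped Classical

noncomputable section

/-- `S h x q = ∑_{x < n ≤ x + h} (n/q)`, where `(n/q)` is the Legendre symbol
(realized by the Jacobi symbol, which agrees with it for prime `q`). -/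
def S (h : ℕ) (x : ℝ) (q : ℕ) : ℤ :=
  ∑ j ∈ Finset.Icc 1 h, jacobiSym (⌊x⌋ + j) q

/-- `M g q h λ = (1/g(q)) · #{m ∈ ℤ : 1 ≤ m ≤ g(q), S_h(m,q) ≤ λ√h}`. -/
def M (g : ℝ → ℝ) (q h : ℕ) (lam : ℝ) : ℝ :=
  (1 / g q) *
    ({m : ℤ | 1 ≤ (m : ℝ) ∧ (m : ℝ) ≤ g q ∧ (S h (m : ℝ) q : ℝ) ≤ lam * Real.sqrt h}).ncard

/-- The standard Gaussian cumulative distribution function. -/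
def gaussLimit (lam : ℝ) : ℝ :=
  (1 / Real.sqrt (2 * Real.pi)) * ∫ t in Set.Iic lam, Real.exp (-t ^ 2 / 2)

/-- A set of primes `B` is `η`-strong if for some `δ > 0`,
`|(P \ B) ∩ [X, X + X^η]| ≤ X^η/(log X)^{1+δ}` for all sufficiently large `X`. -/
def EtaStrong (η : ℝ) (B : Set ℕ) : Prop :=
  ∃ δ > (0 : ℝ), ∀ᶠ X : ℝ in atTop,
    (({p : ℕ | p.Prime ∧ p ∉ B ∧ X ≤ p ∧ (p : ℝ) ≤ X + X ^ η}).ncard : ℝ)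
      ≤ X ^ η / Real.log X ^ (1 + δ)

open Finset in
theorem two_pow_card_le_prod_rpow (ε : ℝ) (hε : 0 < ε) :
    ∃ C : ℝ, 1 ≤ C ∧ ∀ s : Finset ℕ, (∀ p ∈ s, 1 ≤ p) →
      (2 : ℝ) ^ #s ≤ C * ((∏ p ∈ s, p : ℕ) : ℝ) ^ ε := by
  obtain ⟨P, hP⟩ := exists_nat_ge ((2 : ℝ) ^ (1 / ε))
  refine ⟨2 ^ P, one_le_pow₀ (by norm_num), fun s hs => ?_⟩
  have h1 : ∀ p ∈ s, (2 : ℝ) ≤ (if p < P then 2 else 1) * (p : ℝ) ^ ε := by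
    intro p hp
    have hp1 : (1 : ℝ) ≤ p := by exact_mod_cast hs p hp
    split_ifs with h
    · have := Real.one_le_rpow hp1 hε.le
      linarith
    · have h2 : (2 : ℝ) ^ (1 / ε) ≤ p := hP.trans (by exact_mod_cast not_lt.1 h)
      have := Real.rpow_le_rpow (by positivity) h2 hε.le
      rw [← Real.rpow_mul (by norm_num), one_div, inv_mul_cancel₀ hε.ne', Real.rpow_one] at this
      linarith
  calc (2 : ℝ) ^ #s = ∏ p ∈ s, 2 := by simp
    _ ≤ ∏ p ∈ s, ((if p < P then 2 else 1) * (p : ℝ) ^ ε) :=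
        prod_le_prod (fun _ _ => by norm_num) h1
    _ = 2 ^ #(s.filter (· < P)) * ((∏ p ∈ s, p : ℕ) : ℝ) ^ ε := by
        rw [prod_mul_distrib, prod_ite, Real.finsetProd_rpow _ _ (fun _ _ => by positivity)]
        simp
    _ ≤ _ := by
        refine mul_le_mul_of_nonneg_right (pow_le_pow_right₀ (by norm_num) ?_) (by positivity)
        refine (card_le_card (t := range P) fun x hx => ?_).trans (by simp)
        simpa using (mem_filter.1 hx).2

/-- The primes dividing `n` to an odd power. -/
def oddPrimes (n : ℕ) : Finset ℕ := n.primeFactors.filter fun p => Odd (n.factorization p)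

theorem mem_oddPrimes {n p : ℕ} : p ∈ oddPrimes n ↔ Odd (n.factorization p) := by
  rw [oddPrimes, Finset.mem_filter, and_iff_right_iff_imp]
  intro h
  rw [← Nat.support_factorization, Finsupp.mem_support_iff]
  rintro h0
  simp [h0] at h

theorem prime_of_mem_oddPrimes {n p : ℕ} (h : p ∈ oddPrimes n) : p.Prime :=
  Nat.prime_of_mem_primeFactors (Finset.mem_filter.1 h).1

theorem exists_eq_prod_oddPrimes_mul_sq {n : ℕ} (hn : n ≠ 0) :
    ∃ b, n = (∏ p ∈ oddPrimes n, p) * b ^ 2 := by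
  obtain ⟨a, b, hab, ha⟩ := Nat.sq_mul_squarefree n
  have ha0 : a ≠ 0 := ha.ne_zero
  have hb0 : b ≠ 0 := by rintro rfl; simp at hab; exact hn hab.symm
  refine ⟨b, ?_⟩
  have : oddPrimes n = a.primeFactors := by
    ext p
    rw [mem_oddPrimes, ← hab, Nat.factorization_mul (pow_ne_zero _ hb0) ha0,
      Nat.factorization_pow, ← Nat.support_factorization, Finsupp.mem_support_iff]
    have := ha.natFactorization_le_one p
    simp only [Finsupp.add_apply, Finsupp.smul_apply, smul_eq_mul]
    rw [Nat.odd_iff]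
    omega
  rw [this, Nat.prod_primeFactors_of_squarefree ha, mul_comm, hab]

theorem oddPrimes_eq_of_isSquare_mul {m n : ℕ} (hm : m ≠ 0) (hn : n ≠ 0)
    (h : IsSquare (m * n)) : oddPrimes m = oddPrimes n := by
  obtain ⟨r, hr⟩ := h
  ext p
  have := congrArg (fun x => x.factorization p) hr
  have hr0 : r ≠ 0 := by rintro rfl; simp [hm, hn] at hr
  simp only [Nat.factorization_mul hm hn, Nat.factorization_mul hr0 hr0, Finsupp.add_apply] at this
  rw [mem_oddPrimes, mem_oddPrimes, Nat.odd_iff, Nat.odd_iff]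
  omega

theorem prod_oddPrimes_le {n : ℕ} (hn : n ≠ 0) : ∏ p ∈ oddPrimes n, p ≤ n := by
  refine Nat.le_of_dvd (Nat.pos_of_ne_zero hn) ?_
  obtain ⟨b, hb⟩ := exists_eq_prod_oddPrimes_mul_sq hn
  exact ⟨_, hb⟩

open Finset in
theorem card_oddPrimes_eq_le (N : ℕ) (hN : 1 ≤ N) :
    (#((Icc 1 N ×ˢ Icc 1 N).filter fun x => oddPrimes x.1 = oddPrimes x.2) : ℝ) ≤
      N * (1 + Real.log N) := by
  have h1 : (Icc 1 N ×ˢ Icc 1 N).filter (fun x => oddPrimes x.1 = oddPrimes x.2) ⊆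
      ((Icc 1 N).sigma fun a => Icc 1 (N / a).sqrt ×ˢ Icc 1 (N / a).sqrt).image
        fun y : (_ : ℕ) × ℕ × ℕ => (y.1 * y.2.1 ^ 2, y.1 * y.2.2 ^ 2) := by
    rintro ⟨u, v⟩ h
    simp only [mem_filter, mem_product, mem_Icc] at h
    obtain ⟨⟨⟨hu, huN⟩, hv, hvN⟩, huv⟩ := h
    obtain ⟨b, hb⟩ := exists_eq_prod_oddPrimes_mul_sq (n := u) (by omega)
    obtain ⟨c, hc⟩ := exists_eq_prod_oddPrimes_mul_sq (n := v) (by omega)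
    rw [← huv] at hc
    set a := ∏ p ∈ oddPrimes u, p
    have ha : a ≠ 0 := by intro h; simp [h] at hb; omega
    have hb0 : b ≠ 0 := by rintro rfl; simp at hb; omega
    have hc0 : c ≠ 0 := by rintro rfl; simp at hc; omega
    have key : ∀ x y : ℕ, y ≤ N → y = a * x ^ 2 → x ≤ (N / a).sqrt := by
      intro x y hy hx
      rw [Nat.le_sqrt', Nat.le_div_iff_mul_le (Nat.pos_of_ne_zero ha), mul_comm]
      omega
    have haN : a ≤ N := (Nat.le_mul_of_pos_right a (by positivity)).trans (hb ▸ huN)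
    simp only [mem_image, mem_sigma, mem_product, mem_Icc]
    refine ⟨⟨a, b, c⟩, ⟨⟨Nat.pos_of_ne_zero ha, haN⟩, ⟨Nat.pos_of_ne_zero hb0, key b u huN hb⟩,
      ⟨Nat.pos_of_ne_zero hc0, key c v hvN hc⟩⟩, ?_⟩
    simp only [← hb, ← hc]
  have h2 : (#((Icc 1 N ×ˢ Icc 1 N).filter fun x => oddPrimes x.1 = oddPrimes x.2) : ℝ) ≤
      ∑ a ∈ Icc 1 N, (N : ℝ) / a := by
    refine (Nat.cast_le.2 ((card_le_card h1).trans card_image_le)).trans ?_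
    rw [card_sigma, Nat.cast_sum]
    refine sum_le_sum fun a _ => ?_
    simp only [card_product, Nat.card_Icc, Nat.add_sub_cancel]
    exact (Nat.cast_le.2 (Nat.sqrt_le _)).trans Nat.cast_div_le
  refine h2.trans ?_
  simp_rw [div_eq_mul_inv]
  rw [← mul_sum]
  refine mul_le_mul_of_nonneg_left ?_ (by positivity)
  have := harmonic_le_one_add_log N
  rw [harmonic_eq_sum_Icc] at this
  push_cast at this
  exact this

open Finset in
/-- Pairs agreeing under `s` are at most `T` times as numerous as pairs agreeing under `a`,
when `a` takes at most `T` values on each fibre of `s`. -/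
theorem card_pairs_le_mul_card_pairs {α β γ : Type*} [DecidableEq β] [DecidableEq γ] (Ω : Finset α)
    (s : α → β) (a : α → γ) (T : ℕ) (hT : ∀ x ∈ Ω, #((Ω.filter fun y => s y = s x).image a) ≤ T) :
    #((Ω ×ˢ Ω).filter fun x => s x.1 = s x.2) ≤
      T * #((Ω ×ˢ Ω).filter fun x => a x.1 = a x.2) := by
  have h1 : ∀ σ ∈ Ω.image s, #(Ω.filter fun y => s y = σ) ^ 2 ≤
      T * #((Ω ×ˢ Ω).filter fun x => a x.1 = a x.2 ∧ s x.1 = σ ∧ s x.2 = σ) := by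
    intro σ hσ
    obtain ⟨x, hx, rfl⟩ := mem_image.1 hσ
    set N := Ω.filter fun y => s y = s x
    have h2 : #N = ∑ c ∈ N.image a, #(N.filter fun y => a y = c) :=
      card_eq_sum_card_image a N
    have h3 : #((Ω ×ˢ Ω).filter fun z => a z.1 = a z.2 ∧ s z.1 = s x ∧ s z.2 = s x) =
        ∑ c ∈ N.image a, #(N.filter fun y => a y = c) ^ 2 := by
      rw [card_eq_sum_card_fiberwise (f := fun z => a z.1) (t := N.image a)]
      · refine sum_congr rfl fun c _ => ?_
        rw [sq, ← card_product]
        congr 1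
        ext ⟨y, z⟩
        simp only [mem_filter, mem_product, N]
        constructor
        · rintro ⟨⟨⟨hy, hz⟩, h1, h2, h3⟩, rfl⟩
          exact ⟨⟨⟨hy, h2⟩, rfl⟩, ⟨hz, h3⟩, h1.symm⟩
        · rintro ⟨⟨⟨hy, h2⟩, h4⟩, ⟨hz, h3⟩, h1⟩
          exact ⟨⟨⟨hy, hz⟩, h4.trans h1.symm, h2, h3⟩, h4⟩
      · rintro ⟨y, z⟩ h
        simp only [coe_filter, mem_product, Set.mem_ofPred_eq] at h
        exact mem_coe.2 (mem_image_of_mem a (mem_filter.2 ⟨h.1.1, h.2.2.1⟩))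
    rw [h3, h2]
    refine (sq_sum_le_card_mul_sum_sq).trans (Nat.mul_le_mul_right _ (hT x hx))
  have h4 : #((Ω ×ˢ Ω).filter fun x => s x.1 = s x.2) =
      ∑ σ ∈ Ω.image s, #(Ω.filter fun y => s y = σ) ^ 2 := by
    rw [card_eq_sum_card_fiberwise (f := fun z => s z.1) (t := Ω.image s)]
    · refine sum_congr rfl fun c _ => ?_
      rw [sq, ← card_product]
      congr 1
      ext ⟨y, z⟩
      simp only [mem_filter, mem_product]
      constructor
      · rintro ⟨⟨⟨hy, hz⟩, h1⟩, rfl⟩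
        exact ⟨⟨hy, rfl⟩, hz, h1.symm⟩
      · rintro ⟨⟨hy, h2⟩, hz, h1⟩
        exact ⟨⟨⟨hy, hz⟩, h2.trans h1.symm⟩, h2⟩
    · rintro ⟨y, z⟩ h
      simp only [coe_filter, mem_product, Set.mem_ofPred_eq] at h
      exact mem_coe.2 (mem_image_of_mem s h.1.1)
  rw [h4]
  refine (sum_le_sum h1).trans ?_
  rw [← mul_sum]
  refine Nat.mul_le_mul_left _ ?_
  rw [card_eq_sum_card_fiberwise (f := fun z => s z.1) (t := Ω.image s)
    (s := (Ω ×ˢ Ω).filter fun x => a x.1 = a x.2)]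
  · refine sum_le_sum fun c _ => card_le_card fun z hz => ?_
    simp only [mem_filter] at hz ⊢
    exact ⟨⟨hz.1, hz.2.1⟩, hz.2.2.1⟩
  · rintro ⟨y, z⟩ h
    simp only [coe_filter, mem_product, Set.mem_ofPred_eq] at h
    exact mem_coe.2 (mem_image_of_mem s h.1.1)

/-- The product `∏_{j ∈ J} (m + j)`. -/
def shiftProd (J : Finset ℕ) (m : ℕ) : ℕ := ∏ j ∈ J, (m + j)

theorem shiftProd_ne_zero {J : Finset ℕ} {m : ℕ} (hm : 1 ≤ m) : shiftProd J m ≠ 0 :=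
  Finset.prod_ne_zero_iff.2 fun _ _ => by omega

open Finset in
theorem shiftProd_le {J : Finset ℕ} {m G : ℕ} (hm : m ≤ G) (hJ : J ⊆ Icc 1 G) :
    shiftProd J m ≤ (2 * G) ^ #J := by
  refine prod_le_pow_card _ _ _ fun j hj => ?_
  have := (mem_Icc.1 (hJ hj)).2
  omega

open Finset in
theorem oddPrimes_add_subset {J : Finset ℕ} {j₀ m : ℕ} (hm : 1 ≤ m) (hj₀ : j₀ ∈ J) :
    oddPrimes (m + j₀) ⊆ oddPrimes (shiftProd J m) ∪
      (∏ j ∈ J.erase j₀, ((j : ℤ) - j₀).natAbs).primeFactors := by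
  intro p hp
  have hpp := prime_of_mem_oddPrimes hp
  rw [mem_oddPrimes] at hp
  have hdvd : p ∣ m + j₀ := Nat.dvd_of_factorization_pos (by rintro h; simp [h] at hp)
  rw [mem_union]
  by_cases h : ∃ j ∈ J.erase j₀, p ∣ m + j
  · right
    obtain ⟨j, hj, hpj⟩ := h
    rw [Nat.mem_primeFactors]
    refine ⟨hpp, ?_, ?_⟩
    · refine dvd_trans ?_ (dvd_prod_of_mem _ hj)
      rw [← Int.natCast_dvd]
      have := dvd_sub (Int.natCast_dvd_natCast.2 hpj) (Int.natCast_dvd_natCast.2 hdvd)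
      push_cast at this
      rwa [add_sub_add_left_eq_sub] at this
    · refine prod_ne_zero_iff.2 fun i hi => ?_
      have := (mem_erase.1 hi).1
      omega
  · left
    push Not at h
    rw [mem_oddPrimes, shiftProd, Nat.factorization_prod (fun j _ => by omega),
      Finsupp.finsetSum_apply, sum_eq_single_of_mem j₀ hj₀]
    · exact hp
    · intro j hj hne
      exact Nat.factorization_eq_zero_of_not_dvd (h j (mem_erase.2 ⟨hne, hj⟩))

open Finset in
theorem card_isSquare_pairs_le (k : ℕ) (ε : ℝ) (hε : 0 < ε) :
    ∃ C : ℝ, 1 ≤ C ∧ ∀ G : ℕ, 1 ≤ G → ∀ J : Finset ℕ, J.Nonempty → J ⊆ Icc 1 G → #J ≤ k →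
      (#((Icc 1 G ×ˢ Icc 1 G).filter fun x => IsSquare (shiftProd J x.1 * shiftProd J x.2)) : ℝ) ≤
        C * (G : ℝ) ^ (1 + ε) := by
  set e : ℝ := ε / (2 * k + 1) with he
  have he0 : 0 < e := by positivity
  obtain ⟨C₁, hC₁, h2⟩ := two_pow_card_le_prod_rpow e he0
  refine ⟨C₁ ^ 2 * (1 + 1 / e) * 2 ^ (1 + ε), ?_, fun G hG J hJ hJG hJk => ?_⟩
  · have : (1 : ℝ) ≤ 1 + 1 / e := by
      have : 0 < 1 / e := by positivity
      linarith
    exact one_le_mul_of_one_le_of_one_le (one_le_mul_of_one_le_of_one_le (one_le_pow₀ hC₁) this)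
      (Real.one_le_rpow (by norm_num) (by positivity))
  obtain ⟨j₀, hj₀⟩ := hJ
  have hG2 : (1 : ℝ) ≤ 2 * G := by
    have : (1 : ℝ) ≤ G := by exact_mod_cast hG
    linarith
  set D := ∏ j ∈ J.erase j₀, ((j : ℤ) - j₀).natAbs with hD
  have hD0 : D ≠ 0 := by
    refine prod_ne_zero_iff.2 fun i hi => ?_
    have := (mem_erase.1 hi).1
    omega
  have hDle : D ≤ (2 * G) ^ k := by
    refine (prod_le_pow_card _ _ (2 * G) fun j hj => ?_).trans
      (Nat.pow_le_pow_right (by omega) ((card_erase_le).trans hJk))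
    have h1 := mem_Icc.1 (hJG (mem_of_mem_erase hj))
    have h2 := mem_Icc.1 (hJG hj₀)
    omega
  have aux : ∀ n : ℕ, n ≤ (2 * G) ^ k → (n : ℝ) ^ e ≤ ((2 * G : ℝ)) ^ (k * e) := by
    intro n hn
    rw [Real.rpow_mul (by positivity), Real.rpow_natCast]
    exact Real.rpow_le_rpow (by positivity) (by exact_mod_cast hn) he0.le
  set T := ⌊C₁ ^ 2 * (2 * G : ℝ) ^ (2 * k * e)⌋₊ with hT
  have hfib : ∀ x ∈ Icc 1 G, #(((Icc 1 G).filter fun y => oddPrimes (shiftProd J y) =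
      oddPrimes (shiftProd J x)).image fun y => oddPrimes (y + j₀)) ≤ T := by
    intro x hx
    rw [mem_Icc] at hx
    have hsub : (((Icc 1 G).filter fun y => oddPrimes (shiftProd J y) =
        oddPrimes (shiftProd J x)).image fun y => oddPrimes (y + j₀)) ⊆
        (oddPrimes (shiftProd J x) ∪ D.primeFactors).powerset := by
      intro s hs
      obtain ⟨y, hy, rfl⟩ := mem_image.1 hs
      rw [mem_filter, mem_Icc] at hy
      rw [mem_powerset, ← hy.2]
      exact oddPrimes_add_subset hy.1.1 hj₀
    refine (card_le_card hsub).trans ?_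
    rw [card_powerset]
    refine Nat.le_floor ?_
    push_cast
    have hx0 := shiftProd_ne_zero (J := J) hx.1
    calc (2 : ℝ) ^ #(oddPrimes (shiftProd J x) ∪ D.primeFactors)
        ≤ 2 ^ (#(oddPrimes (shiftProd J x)) + #D.primeFactors) :=
          pow_le_pow_right₀ (by norm_num) (card_union_le _ _)
      _ = 2 ^ #(oddPrimes (shiftProd J x)) * 2 ^ #D.primeFactors := pow_add _ _ _
      _ ≤ (C₁ * (2 * G : ℝ) ^ (k * e)) * (C₁ * (2 * G : ℝ) ^ (k * e)) := by
          gcongr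
          · refine (h2 _ fun p hp => (prime_of_mem_oddPrimes hp).one_le).trans ?_
            gcongr
            refine aux _ ((prod_oddPrimes_le hx0).trans ((shiftProd_le hx.2 hJG).trans ?_))
            exact Nat.pow_le_pow_right (by omega) hJk
          · refine (h2 _ fun p hp => (Nat.prime_of_mem_primeFactors hp).one_le).trans ?_
            gcongr
            exact aux _ ((Nat.le_of_dvd (Nat.pos_of_ne_zero hD0)
              (Nat.prod_primeFactors_dvd D)).trans hDle)
      _ = _ := by
          rw [mul_mul_mul_comm, ← Real.rpow_add (by positivity)]
          ring_nf
  have hshift : (#((Icc 1 G ×ˢ Icc 1 G).filter fun x =>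
      oddPrimes (x.1 + j₀) = oddPrimes (x.2 + j₀)) : ℝ) ≤ (1 + 1 / e) * (2 * G : ℝ) ^ (1 + e) := by
    have h1 := card_oddPrimes_eq_le (2 * G) (by omega)
    have h2 : #((Icc 1 G ×ˢ Icc 1 G).filter fun x =>
        oddPrimes (x.1 + j₀) = oddPrimes (x.2 + j₀)) ≤
        #((Icc 1 (2 * G) ×ˢ Icc 1 (2 * G)).filter fun x => oddPrimes x.1 = oddPrimes x.2) := by
      refine card_le_card_of_injOn (fun x => (x.1 + j₀, x.2 + j₀)) ?_ ?_
      · intro x hx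
        have h3 := mem_Icc.1 (hJG hj₀)
        simp only [coe_filter, mem_product, mem_Icc, Set.mem_ofPred_eq] at hx ⊢
        refine ⟨⟨⟨?_, ?_⟩, ?_, ?_⟩, hx.2⟩ <;> omega
      · rintro ⟨a, b⟩ _ ⟨c, d⟩ _ h
        simpa using h
    refine (Nat.cast_le.2 h2).trans (h1.trans ?_)
    push_cast
    rw [Real.rpow_add (by positivity), Real.rpow_one, mul_left_comm]
    refine mul_le_mul_of_nonneg_left ?_ (by positivity)
    have h4 := Real.log_le_rpow_div (x := 2 * G) (by positivity) he0
    have h5 := Real.one_le_rpow hG2 he0.le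
    rw [add_mul, one_mul, one_div_mul_eq_div]
    linarith
  have hmain := card_pairs_le_mul_card_pairs (Icc 1 G) (fun y => oddPrimes (shiftProd J y))
    (fun y => oddPrimes (y + j₀)) T hfib
  calc (#((Icc 1 G ×ˢ Icc 1 G).filter fun x =>
        IsSquare (shiftProd J x.1 * shiftProd J x.2)) : ℝ)
      ≤ #((Icc 1 G ×ˢ Icc 1 G).filter fun x =>
          oddPrimes (shiftProd J x.1) = oddPrimes (shiftProd J x.2)) := by
        refine Nat.cast_le.2 (card_le_card fun x hx => ?_)
        simp only [mem_filter, mem_product, mem_Icc] at hx ⊢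
        exact ⟨hx.1, oddPrimes_eq_of_isSquare_mul (shiftProd_ne_zero hx.1.1.1)
          (shiftProd_ne_zero hx.1.2.1) hx.2⟩
    _ ≤ T * #((Icc 1 G ×ˢ Icc 1 G).filter fun x =>
          oddPrimes (x.1 + j₀) = oddPrimes (x.2 + j₀)) := by exact_mod_cast hmain
    _ ≤ (C₁ ^ 2 * (2 * G : ℝ) ^ (2 * k * e)) * ((1 + 1 / e) * (2 * G : ℝ) ^ (1 + e)) := by
        gcongr
        exact Nat.floor_le (by positivity)
    _ = C₁ ^ 2 * (1 + 1 / e) * (2 * G : ℝ) ^ (2 * k * e + (1 + e)) := by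
        rw [Real.rpow_add (by positivity) (2 * k * e)]
        ring
    _ = _ := by
        have : 2 * k * e + (1 + e) = 1 + ε := by rw [he]; field_simp; ring
        rw [this, Real.mul_rpow (by norm_num) (by positivity)]
        ring

open Finset in
theorem jacobiSym_natCast_eq_neg_one {N b p₀ : ℕ} (hN : N ≠ 0) (hp₀ : p₀ ∈ oddPrimes N)
    (h : ∀ p ∈ N.primeFactors, jacobiSym p b = if p = p₀ then -1 else 1) :
    jacobiSym N b = -1 := by
  have hm : ∀ (s : Finset ℕ) (f : ℕ → ℤ), jacobiSym (∏ i ∈ s, f i) b =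
      ∏ i ∈ s, jacobiSym (f i) b := by
    intro s f
    induction s using Finset.induction with
    | empty => simp [jacobiSym.one_left]
    | insert a s ha ih => rw [prod_insert ha, prod_insert ha, jacobiSym.mul_left, ih]
  have h1 : (N : ℤ) = ∏ p ∈ N.primeFactors, (p : ℤ) ^ N.factorization p := by
    conv_lhs => rw [← Nat.prod_factorization_pow_eq_self hN]
    rw [Finsupp.prod, Nat.support_factorization]
    push_cast
    rfl
  have hmem : p₀ ∈ N.primeFactors := (mem_filter.1 hp₀).1
  rw [h1, hm, prod_eq_single_of_mem p₀ hmem]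
  · rw [jacobiSym.pow_left, h p₀ hmem, if_pos rfl, (mem_oddPrimes.1 hp₀).neg_one_pow]
  · intro p hp hne
    rw [jacobiSym.pow_left, h p hp, if_neg hne, one_pow]

open Finset in
theorem exists_odd_jacobiSym_eq_neg_one {N : ℕ} (hN : ¬ IsSquare N) :
    ∃ b : ℕ, Odd b ∧ jacobiSym N b = -1 := by
  have hN0 : N ≠ 0 := by rintro rfl; exact hN ⟨0, rfl⟩
  have hne : (oddPrimes N).Nonempty := by
    rw [nonempty_iff_ne_empty]
    intro h
    obtain ⟨b, hb⟩ := exists_eq_prod_oddPrimes_mul_sq hN0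
    rw [h, prod_empty, one_mul] at hb
    exact hN ⟨b, by rw [hb, sq]⟩
  have hrec : ∀ p b : ℕ, p.Prime → p ≠ 2 → b % 4 = 1 → jacobiSym p b = jacobiSym b p :=
    fun p b hp hp2 hb => jacobiSym.quadratic_reciprocity_one_mod_four' (hp.odd_of_ne_two hp2) hb
  by_cases h2 : ∃ p ∈ oddPrimes N, p ≠ 2
  · obtain ⟨p₀, hp₀, hp₀2⟩ := h2
    have hpr := prime_of_mem_oddPrimes hp₀
    have : Fact p₀.Prime := ⟨hpr⟩
    obtain ⟨c, hc⟩ := FiniteField.exists_nonsquare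
      (F := ZMod p₀) (by rwa [ZMod.ringChar_zmod_n])
    have hcop : Nat.Coprime (8 * ∏ p ∈ N.primeFactors.erase p₀, p) p₀ := by
      refine Nat.Coprime.mul_left ?_ (Nat.Coprime.prod_left fun p hp => ?_)
      · exact Nat.Coprime.pow_left 3 ((Nat.coprime_primes Nat.prime_two hpr).2 hp₀2.symm)
      · rw [mem_erase] at hp
        exact (Nat.coprime_primes (Nat.prime_of_mem_primeFactors hp.2) hpr).2 hp.1
    obtain ⟨b, hb1, hb2⟩ := Nat.chineseRemainder hcop 1 c.val
    have hb8 : b % 8 = 1 := hb1.of_mul_right _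
    refine ⟨b, Nat.odd_iff.2 (by omega), jacobiSym_natCast_eq_neg_one hN0 hp₀ fun p hp => ?_⟩
    have hpp := Nat.prime_of_mem_primeFactors hp
    split_ifs with h
    · subst h
      rw [hrec p b hpp hp₀2 (by omega)]
      rw [← jacobiSym.legendreSym.to_jacobiSym, legendreSym.eq_neg_one_iff]
      have : ((b : ℤ) : ZMod p) = c := by
        have := (ZMod.natCast_eq_natCast_iff _ _ _).2 hb2
        simpa using this
      rwa [this]
    · by_cases hp2 : p = 2
      · subst hp2
        have := jacobiSym.at_two (b := b) (Nat.odd_iff.2 (by omega))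
        push_cast
        rw [this, ZMod.χ₈_nat_eq_if_mod_eight]
        simp [hb8]; omega
      · rw [hrec p b hpp hp2 (by omega), jacobiSym.mod_left]
        have h1 : b ≡ 1 [MOD p] := by
          refine Nat.ModEq.of_dvd ?_ hb1
          exact Dvd.dvd.mul_left (dvd_prod_of_mem _ (mem_erase.2 ⟨h, hp⟩)) _
        have h3 : (b : ℤ) % p = 1 % p := by exact_mod_cast h1
        rw [h3, ← jacobiSym.mod_left, jacobiSym.one_left]
  · push Not at h2
    obtain ⟨p, hp⟩ := hne
    obtain rfl := h2 p hp
    have hcop : Nat.Coprime (∏ p ∈ N.primeFactors.erase 2, p) 8 := by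
      refine Nat.Coprime.prod_left fun p hp => ?_
      rw [mem_erase] at hp
      exact Nat.Coprime.pow_right 3
        ((Nat.coprime_primes (Nat.prime_of_mem_primeFactors hp.2) Nat.prime_two).2 hp.1)
    obtain ⟨b, hb1, hb2⟩ := Nat.chineseRemainder hcop 1 5
    have hb8 : b % 8 = 5 := hb2
    refine ⟨b, Nat.odd_iff.2 (by omega), jacobiSym_natCast_eq_neg_one hN0 hp fun p hp => ?_⟩
    have hpp := Nat.prime_of_mem_primeFactors hp
    split_ifs with h
    · subst h
      have := jacobiSym.at_two (b := b) (Nat.odd_iff.2 (by omega))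
      push_cast
      rw [this, ZMod.χ₈_nat_eq_if_mod_eight]
      simp [hb8]; omega
    · rw [hrec p b hpp h (by omega), jacobiSym.mod_left]
      have h1 : b ≡ 1 [MOD p] := Nat.ModEq.of_dvd (dvd_prod_of_mem _ (mem_erase.2 ⟨h, hp⟩)) hb1
      have h3 : (b : ℤ) % p = 1 % p := by exact_mod_cast h1
      rw [h3, ← jacobiSym.mod_left, jacobiSym.one_left]

theorem abs_jacobiSym_le_one (a : ℤ) (b : ℕ) : |jacobiSym a b| ≤ 1 := by
  rcases jacobiSym.trichotomy a b with h | h | h <;> simp [h]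

/-- The function `q ↦ (a/q)` on odd `q`, extended by zero. -/
def oddJacobi (a q : ℕ) : ℤ := if Odd q then jacobiSym a q else 0

theorem abs_oddJacobi_le_one (a q : ℕ) : |oddJacobi a q| ≤ 1 := by
  rw [oddJacobi]
  split_ifs
  · exact abs_jacobiSym_le_one _ _
  · simp

theorem oddJacobi_mul (a b q : ℕ) : oddJacobi (a * b) q = oddJacobi a q * oddJacobi b q := by
  simp only [oddJacobi]
  split_ifs
  · rw [Nat.cast_mul, jacobiSym.mul_left]
  · simp

theorem oddJacobi_mod (a q : ℕ) : oddJacobi a (q % (4 * a)) = oddJacobi a q := by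
  have : Odd (q % (4 * a)) ↔ Odd q := by
    rw [Nat.odd_iff, Nat.odd_iff, Nat.mod_mod_of_dvd _ (Dvd.dvd.mul_right (by norm_num) _)]
  rw [oddJacobi, oddJacobi, if_congr this rfl rfl]
  split_ifs with h
  · exact (jacobiSym.mod_right' a h).symm
  · rfl

open Finset in
theorem abs_sum_range_le_of_periodic {F : ℕ → ℤ} {c : ℕ} (hc : 0 < c) (hF : Function.Periodic F c)
    (h0 : ∑ i ∈ range c, F i = 0) (h1 : ∀ i, |F i| ≤ 1) (n : ℕ) : |∑ i ∈ range n, F i| ≤ c := by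
  have hP : Function.Periodic (fun n => ∑ i ∈ range n, F i) c := by
    intro n
    induction n with
    | zero => simpa using h0
    | succ n ih =>
      simp only at ih ⊢
      rw [sum_range_succ _ n, ← ih, Nat.succ_add_eq_add_succ n c, Nat.add_succ, sum_range_succ, hF n]
  have h2 := hP.map_mod_nat n
  rw [← h2]
  refine (abs_sum_le_sum_abs _ _).trans ((sum_le_sum fun i _ => h1 i).trans ?_)
  simp only [sum_const, card_range, nsmul_eq_mul, mul_one]
  exact_mod_cast (Nat.mod_lt n hc).le

open Finset in
theorem abs_sum_oddJacobi_le {N : ℕ} (hN : ¬ IsSquare N) (u v : ℕ) :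
    |∑ q ∈ Ico u v, oddJacobi N q| ≤ 8 * N := by
  have hN0 : N ≠ 0 := by rintro rfl; exact hN ⟨0, rfl⟩
  obtain ⟨b, hbo, hb⟩ := exists_odd_jacobiSym_eq_neg_one hN
  have hb0 : b ≠ 0 := by rintro rfl; simp at hbo
  have hcop : Nat.Coprime b (4 * N) := by
    refine Nat.Coprime.mul_right (Nat.Coprime.pow_right 2 hbo.coprime_two_right) ?_
    have : jacobiSym N b ≠ 0 := by rw [hb]; norm_num
    have hz : NeZero b := ⟨hb0⟩
    rw [ne_eq, jacobiSym.eq_zero_iff_not_coprime, not_not] at this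
    exact Nat.Coprime.symm this
  have hmul : ∀ q, oddJacobi N (b * q % (4 * N)) = - oddJacobi N q := by
    intro q
    rw [oddJacobi_mod, oddJacobi, oddJacobi]
    by_cases hq : Odd q
    · have hq0 : q ≠ 0 := by rintro rfl; simp at hq
      rw [if_pos (hbo.mul hq), if_pos hq, jacobiSym.mul_right' _ hb0 hq0, hb, neg_one_mul]
    · rw [if_neg (by rw [Nat.odd_mul]; tauto), if_neg hq, neg_zero]
  have hinj : Set.InjOn (fun q => b * q % (4 * N)) (range (4 * N)) := by
    intro x hx y hy h
    have h1 : x ≡ y [MOD 4 * N] := Nat.ModEq.cancel_left_of_coprime (c := b) hcop.symm h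
    exact Nat.ModEq.eq_of_lt_of_lt h1 (by simpa using hx) (by simpa using hy)
  have hmaps : Set.MapsTo (fun q => b * q % (4 * N)) (range (4 * N)) (range (4 * N)) := by
    intro x _
    simpa using Nat.mod_lt _ (by omega)
  have h0 : ∑ i ∈ range (4 * N), oddJacobi N i = 0 := by
    have : ∑ i ∈ range (4 * N), - oddJacobi N i = ∑ i ∈ range (4 * N), oddJacobi N i :=
      sum_nbij (fun q => b * q % (4 * N)) hmaps hinj
        (surjOn_of_injOn_of_card_le _ hmaps hinj le_rfl) (fun q _ => (hmul q).symm)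
    rw [sum_neg_distrib] at this
    omega
  have hper : Function.Periodic (oddJacobi N) (4 * N) := fun q => by
    rw [← oddJacobi_mod, Nat.add_mod_right, oddJacobi_mod]
  have key := abs_sum_range_le_of_periodic (by omega) hper h0 (abs_oddJacobi_le_one N)
  rcases le_total u v with huv | huv
  · rw [sum_Ico_eq_sub _ huv]
    have h1 := key u
    have h2 := key v
    push_cast at h1 h2
    rw [abs_le] at *
    constructor <;> linarith
  · rw [Ico_eq_empty_of_le huv]
    simp

open Finset in
theorem card_large_sum_mul_sq_le {J : Finset ℕ} {G : ℕ} (hJ : J ⊆ Icc 1 G) (u v : ℕ) {W : ℝ}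
    (hW : 0 ≤ W) :
    (#((Ico u v).filter fun q => W ≤ |∑ m ∈ Icc 1 G, (oddJacobi (shiftProd J m) q : ℝ)|) : ℝ) *
        W ^ 2 ≤
      #((Icc 1 G ×ˢ Icc 1 G).filter fun x => IsSquare (shiftProd J x.1 * shiftProd J x.2)) *
        (v - u : ℕ) + G ^ 2 * (8 * (2 * G) ^ (2 * #J)) := by
  set P := Icc 1 G ×ˢ Icc 1 G with hP
  have h1 : (#((Ico u v).filter fun q =>
      W ≤ |∑ m ∈ Icc 1 G, (oddJacobi (shiftProd J m) q : ℝ)|) : ℝ) * W ^ 2 ≤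
      ∑ q ∈ Ico u v, (∑ m ∈ Icc 1 G, (oddJacobi (shiftProd J m) q : ℝ)) ^ 2 := by
    rw [← nsmul_eq_mul]
    refine (card_nsmul_le_sum _ _ _ fun q hq => ?_).trans
      (sum_le_sum_of_subset_of_nonneg (filter_subset _ _) fun _ _ _ => sq_nonneg _)
    rw [← sq_abs (∑ m ∈ Icc 1 G, _)]
    exact pow_le_pow_left₀ hW (mem_filter.1 hq).2 2
  have h2 : ∑ q ∈ Ico u v, (∑ m ∈ Icc 1 G, (oddJacobi (shiftProd J m) q : ℝ)) ^ 2 =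
      ∑ x ∈ P, ((∑ q ∈ Ico u v, oddJacobi (shiftProd J x.1 * shiftProd J x.2) q : ℤ) : ℝ) := by
    push_cast
    rw [sum_comm]
    refine sum_congr rfl fun q _ => ?_
    rw [sq, sum_mul_sum, ← sum_product']
    simp only [oddJacobi_mul, Int.cast_mul, hP]
  have h3 : ∀ x ∈ P, ((∑ q ∈ Ico u v, oddJacobi (shiftProd J x.1 * shiftProd J x.2) q : ℤ) : ℝ) ≤
      (if IsSquare (shiftProd J x.1 * shiftProd J x.2) then ((v - u : ℕ) : ℝ) else 0) +
        8 * (2 * G) ^ (2 * #J) := by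
    intro x hx
    rw [hP, mem_product, mem_Icc, mem_Icc] at hx
    split_ifs with h
    · refine le_add_of_le_of_nonneg ?_ (by positivity)
      have : ∑ q ∈ Ico u v, oddJacobi (shiftProd J x.1 * shiftProd J x.2) q ≤ ((v - u : ℕ) : ℤ) :=
        (sum_le_sum fun q _ => (abs_le.1 (abs_oddJacobi_le_one _ q)).2).trans (by simp)
      exact_mod_cast this
    · rw [zero_add]
      have h4 := (le_abs_self _).trans (abs_sum_oddJacobi_le h u v)
      have h5 : shiftProd J x.1 * shiftProd J x.2 ≤ (2 * G) ^ (2 * #J) := by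
        rw [two_mul #J, pow_add]
        exact Nat.mul_le_mul (shiftProd_le hx.1.2 hJ) (shiftProd_le hx.2.2 hJ)
      have h6 : ∑ q ∈ Ico u v, oddJacobi (shiftProd J x.1 * shiftProd J x.2) q ≤
          ((8 * (2 * G) ^ (2 * #J) : ℕ) : ℤ) := by
        refine h4.trans ?_
        exact_mod_cast Nat.mul_le_mul_left 8 h5
      exact_mod_cast h6
  rw [h2] at h1
  refine h1.trans ((sum_le_sum h3).trans ?_)
  rw [sum_add_distrib, ← sum_filter, sum_const, sum_const]
  simp only [nsmul_eq_mul, hP, card_product, Nat.card_Icc, Nat.add_sub_cancel, Nat.cast_mul]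
  rw [← sq]

theorem rpow_add_one_sub_rpow_le {A L : ℝ} (hA : 1 ≤ A) (hL : 0 ≤ L) :
    (L + 1) ^ A - L ^ A ≤ A * (L + 1) ^ (A - 1) := by
  have h1 : (0 : ℝ) < L + 1 := by linarith
  have h2 := one_add_mul_self_le_rpow_one_add (s := -1 / (L + 1))
    (by rw [le_div_iff₀ h1]; linarith) hA
  have h3 : 1 + -1 / (L + 1) = L / (L + 1) := by field_simp; ring
  rw [h3, Real.div_rpow hL h1.le, le_div_iff₀ (by positivity)] at h2
  rw [Real.rpow_sub_one h1.ne']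
  have h4 : (1 + A * (-1 / (L + 1))) * (L + 1) ^ A =
    (L + 1) ^ A - A * ((L + 1) ^ A / (L + 1)) := by field_simp; ring
  linarith

/-- Primes `q` for which some `k`-fold correlation of `(·/q)` with shifts at most `h q`,
over `m ≤ (log q) ^ A`, exceeds `(log q) ^ (A - c)`. -/
def exceptionalSet (A c : ℝ) (h : ℕ → ℕ) (k : ℕ) : Set ℕ :=
  {q | ∃ J ⊆ Finset.Icc 1 (h q), J.card = k ∧ Real.log q ^ (A - c) <
    |∑ m ∈ Finset.Icc 1 ⌊Real.log q ^ A⌋₊, (jacobiSym (shiftProd J m : ℕ) q : ℝ)|}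

open Finset in
/-- An exceptional prime is counted by a large sum whose length depends only on `X`. -/
theorem le_abs_sum_oddJacobi {A c X : ℝ} {q : ℕ} {J : Finset ℕ} (hA : 1 ≤ A) (hc : c ≤ A)
    (hX : 3 ≤ X) (hXq : X ≤ q) (hqX : (q : ℝ) ≤ 2 * X) (hq : q.Prime)
    (hL : A * (Real.log X + 1) ^ (A - 1) + 1 ≤ Real.log X ^ (A - c) / 2)
    (hJ : Real.log q ^ (A - c) <
      |∑ m ∈ Icc 1 ⌊Real.log q ^ A⌋₊, (jacobiSym (shiftProd J m : ℕ) q : ℝ)|) :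
    Real.log X ^ (A - c) / 2 ≤
      |∑ m ∈ Icc 1 ⌊Real.log X ^ A⌋₊, (oddJacobi (shiftProd J m) q : ℝ)| := by
  have hL0 : 0 ≤ Real.log X := Real.log_nonneg (by linarith)
  have hq2 : q ≠ 2 := by
    rintro rfl
    norm_num at hXq
    linarith
  have hodd : ∀ a : ℕ, jacobiSym a q = oddJacobi a q := fun a => by
    rw [oddJacobi, if_pos (hq.odd_of_ne_two hq2)]
  simp_rw [hodd] at hJ
  have hlog1 : Real.log X ≤ Real.log q := Real.log_le_log (by linarith) hXq
  have hlog2 : Real.log q ≤ Real.log X + 1 := by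
    have h1 := Real.log_le_log (by linarith) hqX
    rw [Real.log_mul (by norm_num) (by linarith)] at h1
    have := Real.log_two_lt_d9
    linarith
  set G := ⌊Real.log X ^ A⌋₊
  set G' := ⌊Real.log q ^ A⌋₊
  have hGG : G ≤ G' := Nat.floor_mono (Real.rpow_le_rpow hL0 hlog1 (by linarith))
  have h1 : ∑ m ∈ Icc 1 G', (oddJacobi (shiftProd J m) q : ℝ) =
      ∑ m ∈ Icc 1 G, (oddJacobi (shiftProd J m) q : ℝ) +
        ∑ m ∈ Ioc G G', (oddJacobi (shiftProd J m) q : ℝ) := by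
    have : ∀ n, Icc 1 n = Ioc 0 n := fun n => by ext; simp [Nat.lt_iff_add_one_le]
    rw [this, this, sum_Ioc_consecutive _ (Nat.zero_le _) hGG]
  have h2 : |∑ m ∈ Ioc G G', (oddJacobi (shiftProd J m) q : ℝ)| ≤ Real.log X ^ (A - c) / 2 := by
    refine (abs_sum_le_sum_abs _ _).trans ((sum_le_sum (g := fun _ => (1 : ℝ))
      fun m _ => ?_).trans ?_)
    · exact_mod_cast abs_oddJacobi_le_one _ q
    · rw [sum_const, Nat.card_Ioc, nsmul_eq_mul, mul_one, Nat.cast_sub hGG]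
      have h3 : (G' : ℝ) ≤ Real.log q ^ A := Nat.floor_le (Real.rpow_nonneg (hL0.trans hlog1) _)
      have h4 : Real.log X ^ A < G + 1 := Nat.lt_floor_add_one _
      have h5 : Real.log q ^ A ≤ (Real.log X + 1) ^ A :=
        Real.rpow_le_rpow (hL0.trans hlog1) hlog2 (by linarith)
      have := rpow_add_one_sub_rpow_le hA hL0
      linarith
  have h3 : Real.log X ^ (A - c) ≤ Real.log q ^ (A - c) :=
    Real.rpow_le_rpow hL0 hlog1 (by linarith)
  rw [h1] at hJ
  have := abs_add_le (∑ m ∈ Icc 1 G, (oddJacobi (shiftProd J m) q : ℝ))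
    (∑ m ∈ Ioc G G', (oddJacobi (shiftProd J m) q : ℝ))
  linarith

theorem exists_etaStrong_eventually_notMem {η δ : ℝ} (hη : η ≤ 1) (hδ : 0 < δ) (E : ℕ → Set ℕ)
    (hE : ∀ k, ∀ ε > (0 : ℝ), ∀ᶠ X : ℝ in atTop,
      (({p : ℕ | p.Prime ∧ p ∈ E k ∧ X ≤ p ∧ (p : ℝ) ≤ X + X ^ η}).ncard : ℝ) ≤
        ε * (X ^ η / Real.log X ^ (1 + δ))) :
    ∃ B : Set ℕ, B ⊆ {p : ℕ | p.Prime} ∧ EtaStrong η B ∧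
      ∀ k, ∀ᶠ q in atTop ⊓ 𝓟 B, q ∉ E k := by
  have h1 : ∀ k : ℕ, ∃ Y : ℝ, (k : ℝ) ≤ Y ∧ ∀ X ≥ Y,
      (({p : ℕ | p.Prime ∧ p ∈ E k ∧ X ≤ p ∧ (p : ℝ) ≤ X + X ^ η}).ncard : ℝ) ≤
        (1 / 2) ^ (k + 1) * (X ^ η / Real.log X ^ (1 + δ)) := by
    intro k
    obtain ⟨Y, hY⟩ := eventually_atTop.1 (hE k ((1 / 2) ^ (k + 1)) (by positivity))
    exact ⟨max k Y, le_max_left _ _, fun X hX => hY X ((le_max_right _ _).trans hX)⟩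
  choose Y hkY hY using h1
  refine ⟨{p | p.Prime ∧ ∀ k, 2 * Y k ≤ p → p ∉ E k}, fun p hp => hp.1, ⟨δ, hδ, ?_⟩, fun k => ?_⟩
  · filter_upwards [eventually_ge_atTop 1] with X hX
    have hXη : X ^ η ≤ X := by
      simpa using Real.rpow_le_rpow_of_exponent_le hX hη
    set F : ℕ → Set ℕ := fun k => {p : ℕ | p.Prime ∧ p ∈ E k ∧ X ≤ p ∧ (p : ℝ) ≤ X + X ^ η} with hF
    set K := (Finset.range (⌊X⌋₊ + 1)).filter fun k => Y k ≤ X with hK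
    have hfin : (⋃ k ∈ K, F k).Finite := by
      refine (Set.finite_Iic ⌊X + X ^ η⌋₊).subset fun p hp => ?_
      simp only [Set.mem_iUnion] at hp
      obtain ⟨k, _, hp⟩ := hp
      exact Nat.le_floor hp.2.2.2
    have hsub : {p : ℕ | p.Prime ∧ p ∉ {p : ℕ | p.Prime ∧ ∀ k, 2 * Y k ≤ p → p ∉ E k} ∧
        X ≤ p ∧ (p : ℝ) ≤ X + X ^ η} ⊆ ⋃ k ∈ K, F k := by
      rintro p ⟨hp, hpB, hXp, hpX⟩
      simp only [Set.mem_ofPred_eq, not_and, not_forall, not_not] at hpB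
      obtain ⟨k, hk, hpk⟩ := hpB hp
      have hYX : Y k ≤ X := by linarith
      simp only [Set.mem_iUnion]
      refine ⟨k, ?_, hp, hpk, hXp, hpX⟩
      rw [hK, Finset.mem_filter, Finset.mem_range, Nat.lt_add_one_iff]
      exact ⟨Nat.le_floor ((hkY k).trans hYX), hYX⟩
    have h2 : ∀ k ∈ K, ((F k).ncard : ℝ) ≤ (1 / 2) ^ (k + 1) * (X ^ η / Real.log X ^ (1 + δ)) :=
      fun k hk => hY k X (Finset.mem_filter.1 hk).2
    have h3 : ∑ k ∈ K, (1 / 2 : ℝ) ^ (k + 1) ≤ 1 := by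
      refine (Finset.sum_le_sum_of_subset_of_nonneg (Finset.filter_subset _ _)
        fun _ _ _ => by positivity).trans ?_
      simp_rw [pow_succ]
      rw [← Finset.sum_mul]
      have := sum_geometric_two_le (⌊X⌋₊ + 1)
      linarith
    have h0 : 0 ≤ X ^ η / Real.log X ^ (1 + δ) := by
      have := Real.log_nonneg hX
      positivity
    calc _ ≤ ((⋃ k ∈ K, F k).ncard : ℝ) := Nat.cast_le.2 (Set.ncard_le_ncard hsub hfin)
      _ ≤ ∑ k ∈ K, ((F k).ncard : ℝ) := by
        exact_mod_cast Finset.set_ncard_biUnion_le K F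
      _ ≤ _ := by
        refine (Finset.sum_le_sum h2).trans ?_
        rw [← Finset.sum_mul]
        exact mul_le_of_le_one_left h0 h3
  · rw [eventually_inf_principal]
    filter_upwards [tendsto_natCast_atTop_atTop.eventually_ge_atTop (2 * Y k)] with q hq hqB
    exact hqB.2 k hq

open Finset in
theorem ncard_exceptionalSet_mul_le {A c X η τ D : ℝ} {h : ℕ → ℕ} {k G H : ℕ} (hk : 1 ≤ k)
    (hA : 1 ≤ A) (hc : c ≤ A) (hτ : 0 ≤ τ) (hX : 3 ≤ X) (hη : η ≤ 1)
    (hL : A * (Real.log X + 1) ^ (A - 1) + 1 ≤ Real.log X ^ (A - c) / 2)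
    (hG : G = ⌊Real.log X ^ A⌋₊) (hH : H = ⌊(2 * Real.log X) ^ τ⌋₊) (hHG : H ≤ G)
    (hL1 : 1 ≤ Real.log X)
    (hh : ∀ q : ℕ, q.Prime → X ≤ q → (h q : ℝ) ≤ Real.log q ^ τ) (hD0 : 0 ≤ D)
    (hD : ∀ J : Finset ℕ, J.Nonempty → J ⊆ Icc 1 G → #J ≤ k →
      (#((Icc 1 G ×ˢ Icc 1 G).filter fun x => IsSquare (shiftProd J x.1 * shiftProd J x.2)) : ℝ) ≤
        D) :
    (({p : ℕ | p.Prime ∧ p ∈ exceptionalSet A c h k ∧ X ≤ p ∧ (p : ℝ) ≤ X + X ^ η}).ncard : ℝ) *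
        (Real.log X ^ (A - c) / 2) ^ 2 ≤
      H ^ k * (D * (X ^ η + 1) + G ^ 2 * (8 * (2 * G) ^ (2 * k))) := by
  set W := Real.log X ^ (A - c) / 2 with hW
  set u := ⌈X⌉₊
  set v := ⌊X + X ^ η⌋₊ + 1
  set F : Finset ℕ → Finset ℕ := fun J => (Ico u v).filter fun q =>
    W ≤ |∑ m ∈ Icc 1 G, (oddJacobi (shiftProd J m) q : ℝ)| with hF
  have hXη : X ^ η ≤ X := by
    simpa using Real.rpow_le_rpow_of_exponent_le (by linarith : 1 ≤ X) hη
  have hsub : {p : ℕ | p.Prime ∧ p ∈ exceptionalSet A c h k ∧ X ≤ p ∧ (p : ℝ) ≤ X + X ^ η} ⊆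
      ((powersetCard k (Icc 1 H)).biUnion F : Finset ℕ) := by
    rintro q ⟨hq, ⟨J, hJ, hJk, hJq⟩, hXq, hqX⟩
    have hlog : Real.log q ≤ 2 * Real.log X := by
      have h1 := Real.log_le_log (by linarith) (hqX.trans (by linarith : X + X ^ η ≤ 2 * X))
      rw [Real.log_mul (by norm_num) (by linarith)] at h1
      have := Real.log_two_lt_d9
      linarith
    have hlog0 : 0 ≤ Real.log q := Real.log_nonneg (by linarith)
    have hhH : h q ≤ H := by
      rw [hH]
      exact Nat.le_floor ((hh q hq hXq).trans (Real.rpow_le_rpow hlog0 hlog hτ))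
    simp only [coe_biUnion, Set.mem_iUnion]
    refine ⟨J, ?_, ?_⟩
    · rw [mem_coe, mem_powersetCard]
      exact ⟨hJ.trans (Icc_subset_Icc le_rfl hhH), hJk⟩
    · rw [mem_coe, hF, mem_filter, mem_Ico]
      refine ⟨⟨Nat.ceil_le.2 hXq, Nat.lt_succ_of_le (Nat.le_floor hqX)⟩, ?_⟩
      rw [hG]
      exact le_abs_sum_oddJacobi hA hc hX hXq (by linarith) hq hL hJq
  have hJF : ∀ J ∈ powersetCard k (Icc 1 H),
      (#(F J) : ℝ) * W ^ 2 ≤ D * (X ^ η + 1) + G ^ 2 * (8 * (2 * G) ^ (2 * k)) := by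
    intro J hJ
    rw [mem_powersetCard] at hJ
    have hJG : J ⊆ Icc 1 G := hJ.1.trans (Icc_subset_Icc le_rfl hHG)
    have h1 := card_large_sum_mul_sq_le hJG u v (W := W) (by positivity)
    have h2 := hD J (card_pos.1 (by omega)) hJG hJ.2.le
    have h3 : ((v - u : ℕ) : ℝ) ≤ X ^ η + 1 := by
      rcases le_total u v with huv | huv
      · rw [Nat.cast_sub huv]
        have h4 : X ≤ u := Nat.le_ceil X
        have h5 : (⌊X + X ^ η⌋₊ : ℝ) ≤ X + X ^ η := Nat.floor_le (by positivity)
        have h6 : (v : ℝ) = ⌊X + X ^ η⌋₊ + 1 := by simp [v]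
        linarith
      · rw [Nat.sub_eq_zero_of_le huv]
        simp only [Nat.cast_zero]
        positivity
    rw [hJ.2] at h1
    refine h1.trans ?_
    gcongr
  have h1 : (({p : ℕ | p.Prime ∧ p ∈ exceptionalSet A c h k ∧ X ≤ p ∧
      (p : ℝ) ≤ X + X ^ η}).ncard : ℝ) ≤ ∑ J ∈ powersetCard k (Icc 1 H), (#(F J) : ℝ) := by
    have := (Set.ncard_le_ncard hsub (finite_toSet _)).trans_eq (Set.ncard_coe_finset _)
    exact_mod_cast this.trans card_biUnion_le
  calc _ ≤ (∑ J ∈ powersetCard k (Icc 1 H), (#(F J) : ℝ)) * W ^ 2 := by gcongr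
    _ = ∑ J ∈ powersetCard k (Icc 1 H), (#(F J) : ℝ) * W ^ 2 := sum_mul _ _ _
    _ ≤ #(powersetCard k (Icc 1 H)) *
        (D * (X ^ η + 1) + G ^ 2 * (8 * (2 * G) ^ (2 * k))) := by
      rw [← nsmul_eq_mul]
      exact sum_le_card_nsmul _ _ _ hJF
    _ ≤ _ := by
      gcongr
      rw [card_powersetCard, Nat.card_Icc, Nat.add_sub_cancel]
      exact_mod_cast Nat.choose_le_pow H k

theorem eventually_le_rpow_of_log_div_log_log {h : ℕ → ℕ}
    (hsmall : Tendsto (fun q : ℕ => Real.log (h q) / Real.log (Real.log q))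
      (atTop ⊓ 𝓟 {p : ℕ | p.Prime}) (𝓝 0)) {τ : ℝ} (hτ : 0 < τ) :
    ∀ᶠ X : ℝ in atTop, ∀ q : ℕ, q.Prime → X ≤ q → (h q : ℝ) ≤ Real.log q ^ τ := by
  have h1 := hsmall.eventually_lt_const hτ
  rw [eventually_inf_principal] at h1
  have h2 : ∀ᶠ q : ℕ in atTop, 1 < Real.log q :=
    (Real.tendsto_log_atTop.comp tendsto_natCast_atTop_atTop).eventually_gt_atTop 1
  obtain ⟨N, hN⟩ := eventually_atTop.1 (h1.and h2)
  filter_upwards [eventually_ge_atTop (N : ℝ)] with X hX q hq hXq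
  obtain ⟨h3, h4⟩ := hN q (by exact_mod_cast hX.trans hXq)
  have h5 := h3 hq
  rw [div_lt_iff₀ (Real.log_pos h4)] at h5
  rcases Nat.eq_zero_or_pos (h q) with h0 | h0
  · rw [h0, Nat.cast_zero]
    exact Real.rpow_nonneg (by linarith) _
  · rw [Real.rpow_def_of_pos (by linarith), ← Real.log_le_iff_le_exp (by exact_mod_cast h0)]
    linarith

theorem eventually_ncard_exceptionalSet_le {A η : ℝ} (hA : 1 < A) (hη0 : 0 < η) (hη : η ≤ 1)
    {h : ℕ → ℕ}
    (hsmall : Tendsto (fun q : ℕ => Real.log (h q) / Real.log (Real.log q))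
      (atTop ⊓ 𝓟 {p : ℕ | p.Prime}) (𝓝 0)) {k : ℕ} (hk : 1 ≤ k) {ρ c : ℝ} (hρ0 : 0 < ρ)
    (hρ : 8 * ρ ≤ A - 1) (hcρ : c ≤ ρ) (hc1 : c < 1) {ε : ℝ} (hε : 0 < ε) :
    ∀ᶠ X : ℝ in atTop,
      (({p : ℕ | p.Prime ∧ p ∈ exceptionalSet A c h k ∧ X ≤ p ∧ (p : ℝ) ≤ X + X ^ η}).ncard : ℝ) ≤
        ε * (X ^ η / Real.log X ^ (1 + ρ)) := by
  have hA0 : 0 < A := by linarith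
  obtain ⟨C, hC1, hC⟩ := card_isSquare_pairs_le k (ρ / A) (by positivity)
  have hk0 : (0 : ℝ) < k := by exact_mod_cast hk
  set τ := ρ / k with hτ
  have hτ0 : 0 < τ := by positivity
  have hτρ : τ ≤ ρ := div_le_self hρ0.le (by exact_mod_cast hk)
  have hlog := Real.tendsto_log_atTop
  have e1 : ∀ᶠ L : ℝ in atTop, A * (L + 1) ^ (A - 1) + 1 ≤ L ^ (A - c) / 2 := by
    have h1 := (tendsto_rpow_atTop (by linarith : 0 < 1 - c)).eventually_ge_atTop
      (2 * (A * 2 ^ (A - 1) + 1))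
    filter_upwards [h1, eventually_ge_atTop 1] with L hL hL1
    have h2 : L ^ (A - c) = L ^ (A - 1) * L ^ (1 - c) := by
      rw [← Real.rpow_add (by linarith)]; ring_nf
    have h3 : (L + 1) ^ (A - 1) ≤ 2 ^ (A - 1) * L ^ (A - 1) := by
      rw [← Real.mul_rpow (by norm_num) (by linarith)]
      exact Real.rpow_le_rpow (by linarith) (by linarith) (by linarith)
    have h4 : 1 ≤ L ^ (A - 1) := Real.one_le_rpow hL1 (by linarith)
    rw [h2]
    calc A * (L + 1) ^ (A - 1) + 1 ≤ A * (2 ^ (A - 1) * L ^ (A - 1)) + L ^ (A - 1) := by gcongr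
      _ = L ^ (A - 1) * (2 * (A * 2 ^ (A - 1) + 1)) / 2 := by ring
      _ ≤ _ := by gcongr
  have e2 : ∀ᶠ L : ℝ in atTop, (2 * L) ^ τ ≤ L ^ A := by
    have h1 := (tendsto_rpow_atTop (by linarith : 0 < A - τ)).eventually_ge_atTop (2 ^ τ)
    filter_upwards [h1, eventually_ge_atTop 1] with L hL hL1
    rw [Real.mul_rpow (by norm_num) (by linarith)]
    calc _ ≤ L ^ (A - τ) * L ^ τ := by gcongr
      _ = L ^ A := by rw [← Real.rpow_add (by linarith)]; ring_nf
  set K : ℝ := 12 * C * 2 ^ ρ with hK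
  have e3 := (tendsto_rpow_atTop (by linarith : 0 < 3 * ρ)).eventually_ge_atTop (K / ε)
  have e4 : ∀ᶠ X : ℝ in atTop, 8 * 4 ^ k * Real.log X ^ (2 * A + 2 * k * A) ≤ X ^ η := by
    have h1 := (isLittleO_log_rpow_rpow_atTop (2 * A + 2 * k * A) hη0).bound
      (c := 1 / (8 * 4 ^ k)) (by positivity)
    filter_upwards [h1, eventually_ge_atTop 1] with X hX hX1
    have := Real.log_nonneg hX1
    rw [Real.norm_of_nonneg (by positivity), Real.norm_of_nonneg (by positivity),
      one_div_mul_eq_div, le_div_iff₀ (by positivity)] at hX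
    linarith
  filter_upwards [hlog.eventually e1, hlog.eventually e2, hlog.eventually e3, e4,
    eventually_ge_atTop 3, hlog.eventually_ge_atTop 1,
    eventually_le_rpow_of_log_div_log_log hsmall hτ0] with X h1 h2 h3 h4 hX hL1 hh
  set L := Real.log X
  have hL0 : 0 < L := by linarith
  set G := ⌊L ^ A⌋₊ with hG
  set H := ⌊(2 * L) ^ τ⌋₊ with hH
  have hG1 : 1 ≤ G := Nat.le_floor (by simpa using Real.one_le_rpow hL1 hA0.le)
  have hmain := ncard_exceptionalSet_mul_le (h := h) (c := c) (D := C * (G : ℝ) ^ (1 + ρ / A)) hk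
    hA.le (by linarith) hτ0.le hX hη h1 hG hH (Nat.floor_mono h2) hL1 hh (by positivity)
    (fun J hJ hJG hJk => hC G hG1 J hJ hJG hJk)
  have hGle : (G : ℝ) ≤ L ^ A := Nat.floor_le (by positivity)
  have hHle : (H : ℝ) ^ k ≤ 2 ^ ρ * L ^ ρ := by
    calc (H : ℝ) ^ k ≤ ((2 * L) ^ τ) ^ k := by
          gcongr
          exact Nat.floor_le (by positivity)
      _ = (2 * L) ^ ρ := by
          rw [← Real.rpow_natCast, ← Real.rpow_mul (by positivity), hτ, div_mul_cancel₀ _ hk0.ne']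
      _ = _ := Real.mul_rpow (by norm_num) hL0.le
  have hXη1 : 1 ≤ X ^ η := Real.one_le_rpow (by linarith) hη0.le
  have hD1 : (G : ℝ) ^ (1 + ρ / A) ≤ L ^ (A + ρ) := by
    calc (G : ℝ) ^ (1 + ρ / A) ≤ (L ^ A) ^ (1 + ρ / A) := by gcongr
      _ = L ^ (A + ρ) := by
        rw [← Real.rpow_mul hL0.le]
        congr 1
        field_simp
  have hD2 : (G : ℝ) ^ 2 * (8 * (2 * G) ^ (2 * k)) ≤ X ^ η := by
    refine le_trans ?_ h4
    calc (G : ℝ) ^ 2 * (8 * (2 * G) ^ (2 * k)) ≤ (L ^ A) ^ 2 * (8 * (2 * L ^ A) ^ (2 * k)) := by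
          gcongr
      _ = _ := by
        have h5 : L ^ (2 * A + 2 * k * A) = (L ^ A) ^ 2 * (L ^ A) ^ (2 * k) := by
          rw [← pow_add, ← Real.rpow_natCast (L ^ A), ← Real.rpow_mul hL0.le]
          push_cast
          ring_nf
        have h6 : (2 : ℝ) ^ (2 * k) = 4 ^ k := by rw [pow_mul]; norm_num
        rw [h5, mul_pow 2 (L ^ A), h6]
        ring
  have hLD : 1 ≤ C * L ^ (A + ρ) :=
    one_le_mul_of_one_le_of_one_le hC1 (Real.one_le_rpow hL1 (by linarith))
  have hbr : C * (G : ℝ) ^ (1 + ρ / A) * (X ^ η + 1) + (G : ℝ) ^ 2 * (8 * (2 * G) ^ (2 * k)) ≤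
      3 * (C * L ^ (A + ρ)) * X ^ η := by
    calc _ ≤ C * L ^ (A + ρ) * (X ^ η + X ^ η) + C * L ^ (A + ρ) * X ^ η := by
          refine add_le_add ?_ (hD2.trans (le_mul_of_one_le_left (by positivity) hLD))
          gcongr
      _ = _ := by ring
  have hfin : (({p : ℕ | p.Prime ∧ p ∈ exceptionalSet A c h k ∧ X ≤ p ∧
      (p : ℝ) ≤ X + X ^ η}).ncard : ℝ) * (L ^ (A - c) / 2) ^ 2 ≤
      (2 ^ ρ * L ^ ρ) * (3 * (C * L ^ (A + ρ)) * X ^ η) :=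
    hmain.trans (mul_le_mul hHle hbr (by positivity) (by positivity))
  rw [← le_div_iff₀ (by positivity)] at hfin
  refine hfin.trans ?_
  rw [div_le_iff₀ (by positivity)]
  have h5 : K ≤ ε * L ^ (3 * ρ) := by
    rw [div_le_iff₀ hε] at h3
    linarith
  have h6 : L ^ (3 * ρ) * L ^ ρ * L ^ (A + ρ) ≤ (L ^ (A - c)) ^ 2 / L ^ (1 + ρ) := by
    rw [← Real.rpow_natCast, ← Real.rpow_mul hL0.le, ← Real.rpow_add hL0, ← Real.rpow_add hL0,
      ← Real.rpow_sub hL0]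
    refine Real.rpow_le_rpow_of_exponent_le hL1 ?_
    push_cast
    linarith
  calc 2 ^ ρ * L ^ ρ * (3 * (C * L ^ (A + ρ)) * X ^ η)
      = K / 4 * (L ^ ρ * L ^ (A + ρ) * X ^ η) := by rw [hK]; ring
    _ ≤ ε * L ^ (3 * ρ) / 4 * (L ^ ρ * L ^ (A + ρ) * X ^ η) := by gcongr
    _ = ε / 4 * X ^ η * (L ^ (3 * ρ) * L ^ ρ * L ^ (A + ρ)) := by ring
    _ ≤ ε / 4 * X ^ η * ((L ^ (A - c)) ^ 2 / L ^ (1 + ρ)) := by gcongr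
    _ = _ := by ring

open scoped BigOperators Nat

theorem norm_exp_mul_sub_sum_le {z : ℂ} (hz : z.re = 0) (hz1 : ‖z‖ ≤ 1) (n : ℕ) {x : ℝ}
    (hx : 0 ≤ x) :
    ‖Complex.exp (x * z) - ∑ k ∈ Finset.range n, (x * z) ^ k / (k ! : ℂ)‖ ≤ x ^ n / n ! := by
  induction n generalizing x with
  | zero => simp [Complex.norm_exp, hz]
  | succ n ih =>
    set f : ℕ → ℝ → ℂ := fun n x =>
      Complex.exp (x * z) - ∑ k ∈ Finset.range n, (x * z) ^ k / k ! with hf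
    have hlin : ∀ y : ℝ, HasDerivAt (fun x : ℝ => (x : ℂ) * z) z y := fun y => by
      simpa using (Complex.ofRealCLM.hasDerivAt (x := y)).mul_const z
    have hd : ∀ y : ℝ, HasDerivAt (f (n + 1)) (f n y * z) y := by
      intro y
      have h1 : HasDerivAt (fun x : ℝ => ∑ k ∈ Finset.range (n + 1), ((x : ℂ) * z) ^ k / k !)
          (∑ k ∈ Finset.range (n + 1), k * (y * z) ^ (k - 1) * z / k !) y :=
        HasDerivAt.fun_sum fun k _ => ((hlin y).pow k).div_const _
      have h2 := (hlin y).cexp.sub h1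
      refine h2.congr_deriv ?_
      rw [Finset.sum_range_succ']
      simp only [hf, sub_mul, Finset.sum_mul, Nat.cast_zero, zero_mul, zero_div, add_zero,
        Nat.add_sub_cancel]
      congr 1
      refine Finset.sum_congr rfl fun k _ => ?_
      rw [Nat.factorial_succ, Nat.cast_mul]
      have : ((k + 1 : ℕ) : ℂ) ≠ 0 := Nat.cast_ne_zero.2 k.succ_ne_zero
      field_simp
    have hB : ∀ y : ℝ, HasDerivAt (fun y : ℝ => y ^ (n + 1) / (n + 1)!) (y ^ n / n !) y := by
      intro y
      refine ((hasDerivAt_pow (n + 1) y).div_const ((n + 1)! : ℝ)).congr_deriv ?_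
      rw [Nat.factorial_succ, Nat.cast_mul, Nat.add_sub_cancel]
      have : ((n + 1 : ℕ) : ℝ) ≠ 0 := Nat.cast_ne_zero.2 n.succ_ne_zero
      field_simp
    refine image_norm_le_of_norm_deriv_right_le_deriv_boundary (f := f (n + 1)) (a := 0) (b := x)
      (fun y _ => (hd y).continuousAt.continuousWithinAt)
      (fun y _ => (hd y).hasDerivWithinAt) ?_ hB ?_ (Set.right_mem_Icc.2 hx)
    · simp [hf, Finset.sum_range_succ']
    · intro y hy
      rw [norm_mul]
      exact (mul_le_of_le_one_right (norm_nonneg _) hz1).trans (ih hy.1)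

theorem norm_exp_mul_I_sub_sum_le (n : ℕ) (x : ℝ) :
    ‖Complex.exp (x * Complex.I) - ∑ k ∈ Finset.range n, (x * Complex.I) ^ k / (k ! : ℂ)‖ ≤
      |x| ^ n / n ! := by
  rcases le_total 0 x with h | h
  · rw [abs_of_nonneg h]
    exact norm_exp_mul_sub_sum_le (by simp) (by simp) n h
  · rw [abs_of_nonpos h]
    simpa using norm_exp_mul_sub_sum_le (z := -Complex.I) (by simp) (by simp) n (neg_nonneg.2 h)

/-- The values that a tuple takes an odd number of times. -/
def oddSupport {k : ℕ} (t : Fin k → ℕ) : Finset ℕ :=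
  (Finset.univ.image t).filter fun j => Odd (Finset.univ.filter fun i => t i = j).card

theorem prod_eq_prod_oddSupport {k : ℕ} {t : Fin k → ℕ} {e : ℕ → ℝ} (he : ∀ i, e (t i) ^ 2 = 1) :
    ∏ i, e (t i) = ∏ j ∈ oddSupport t, e j := by
  rw [Finset.prod_comp, oddSupport, Finset.prod_filter]
  refine Finset.prod_congr rfl fun j hj => ?_
  obtain ⟨i, _, rfl⟩ := Finset.mem_image.1 hj
  split_ifs with h
  · obtain ⟨m, hm⟩ := h
    rw [hm, pow_succ, pow_mul, he, one_pow, one_mul]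
  · obtain ⟨m, hm⟩ := Nat.not_odd_iff_even.1 h
    rw [hm, ← two_mul, pow_mul, he, one_pow]

open Finset in
theorem abs_expect_pow_sub_le {ι : Type*} {I : Finset ι} (hI : I.Nonempty) {s : Finset ℕ}
    {e : ι → ℕ → ℝ} (he : ∀ i ∈ I, ∀ j ∈ s, e i j ^ 2 = 1) {k : ℕ} {δ : ℝ} (hδ : 0 ≤ δ)
    (h : ∀ J ⊆ s, J.Nonempty → #J ≤ k → |𝔼 i ∈ I, ∏ j ∈ J, e i j| ≤ δ) :
    |𝔼 i ∈ I, (∑ j ∈ s, e i j) ^ k -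
      #((Fintype.piFinset fun _ : Fin k => s).filter fun t => oddSupport t = ∅)| ≤
        (#s : ℝ) ^ k * δ := by
  have h1 : 𝔼 i ∈ I, (∑ j ∈ s, e i j) ^ k =
      ∑ t ∈ Fintype.piFinset fun _ : Fin k => s, 𝔼 i ∈ I, ∏ j ∈ oddSupport t, e i j := by
    rw [← expect_sum_comm]
    refine expect_congr rfl fun i hi => ?_
    rw [sum_pow']
    exact sum_congr rfl fun t ht =>
      prod_eq_prod_oddSupport fun a => he i hi _ (Fintype.mem_piFinset.1 ht a)
  rw [h1, card_filter, Nat.cast_sum, ← sum_sub_distrib]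
  refine (abs_sum_le_sum_abs _ _).trans ((sum_le_card_nsmul _ _ δ fun t ht => ?_).trans ?_)
  · rcases eq_empty_or_nonempty (oddSupport t) with h0 | h0
    · simp [h0, hI, hδ]
    · rw [if_neg h0.ne_empty, Nat.cast_zero, sub_zero]
      refine h _ (fun j hj => ?_) h0 ?_
      · obtain ⟨a, _, rfl⟩ := mem_image.1 (mem_filter.1 hj).1
        exact Fintype.mem_piFinset.1 ht a
      · exact (card_filter_le _ _).trans (card_image_le.trans (by simp))
  · simp [nsmul_eq_mul]

/-- The signs indexed by subsets: `1` on `σ` and `-1` off `σ`. -/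
def signOf (σ : Finset ℕ) (j : ℕ) : ℝ := if j ∈ σ then 1 else -1

theorem signOf_sq (σ : Finset ℕ) (j : ℕ) : signOf σ j ^ 2 = 1 := by
  unfold signOf
  split_ifs <;> norm_num

open Finset in
theorem expect_powerset_prod_signOf {K : Type*} [Field K] [CharZero K] (s : Finset ℕ)
    (F : ℕ → ℝ → K) :
    𝔼 σ ∈ s.powerset, ∏ j ∈ s, F j (signOf σ j) = ∏ j ∈ s, (F j 1 + F j (-1)) / 2 := by
  rw [prod_div_distrib, prod_add, expect_eq_sum_div_card, card_powerset, prod_const]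
  push_cast
  congr 1
  refine sum_congr rfl fun σ hσ => ?_
  rw [← prod_sdiff (mem_powerset.1 hσ), mul_comm]
  congr 1
  · exact prod_congr rfl fun j hj => by rw [signOf, if_pos hj]
  · exact prod_congr rfl fun j hj => by rw [signOf, if_neg (mem_sdiff.1 hj).2]

open Finset in
theorem expect_powerset_prod_signOf_eq_zero {s J : Finset ℕ} (hJs : J ⊆ s) (hJ : J.Nonempty) :
    𝔼 σ ∈ s.powerset, ∏ j ∈ J, signOf σ j = 0 := by
  have h1 := expect_powerset_prod_signOf s fun j x => if j ∈ J then x else (1 : ℝ)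
  obtain ⟨j, hj⟩ := hJ
  rw [prod_eq_zero (hJs hj) (by simp [hj])] at h1
  rw [← h1]
  refine expect_congr rfl fun σ _ => ?_
  rw [prod_ite_mem, inter_eq_right.2 hJs]

open Finset in
theorem expect_powerset_cexp (s : Finset ℕ) (y : ℝ) :
    𝔼 σ ∈ s.powerset, Complex.exp ((y * ∑ j ∈ s, signOf σ j : ℝ) * Complex.I) =
      (Real.cos y : ℂ) ^ #s := by
  have h1 := expect_powerset_prod_signOf s fun _ x => Complex.exp ((y * x : ℝ) * Complex.I)
  rw [prod_const] at h1
  rw [Complex.ofReal_cos, Complex.cos]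
  convert h1 using 2
  · rw [← Complex.exp_sum, mul_sum, Complex.ofReal_sum, sum_mul]
  · simp

open Finset in
theorem expect_powerset_exp (s : Finset ℕ) (y : ℝ) :
    𝔼 σ ∈ s.powerset, Real.exp (y * ∑ j ∈ s, signOf σ j) = Real.cosh y ^ #s := by
  have h1 := expect_powerset_prod_signOf s fun _ x => Real.exp (y * x)
  rw [prod_const] at h1
  rw [Real.cosh_eq]
  convert h1 using 2
  · rw [← Real.exp_sum, mul_sum]
  · simp

open Finset in
theorem expect_powerset_pow_le (s : Finset ℕ) (y : ℝ) (K : ℕ) :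
    |y| ^ (2 * K) / (2 * K)! * 𝔼 σ ∈ s.powerset, (∑ j ∈ s, signOf σ j) ^ (2 * K) ≤
      (1 / 4) ^ K * Real.exp (2 * (#s * y ^ 2)) := by
  have h1 : ∀ x : ℝ, x ^ (2 * K) / (2 * K)! ≤ (1 / 4) ^ K * Real.cosh (2 * x) := by
    intro x
    have h2 := (Real.hasSum_cosh (2 * x)).summable.le_tsum K fun n _ => by
      rw [pow_mul]; positivity
    rw [(Real.hasSum_cosh (2 * x)).tsum_eq, mul_pow, pow_mul 2] at h2
    calc x ^ (2 * K) / (2 * K)! =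
        (1 / 4) ^ K * ((2 ^ 2) ^ K * x ^ (2 * K) / (2 * K)!) := by
          rw [← mul_div_assoc, ← mul_assoc, ← mul_pow]
          norm_num
      _ ≤ _ := by gcongr
  have h2 : 𝔼 σ ∈ s.powerset, Real.cosh (2 * (y * ∑ j ∈ s, signOf σ j)) =
      Real.cosh (2 * y) ^ #s := by
    have h3 := expect_powerset_exp s (2 * y)
    have h4 := expect_powerset_exp s (-(2 * y))
    rw [Real.cosh_neg] at h4
    simp_rw [Real.cosh_eq (2 * (y * _)), ← expect_div, expect_add_distrib]
    simp_rw [← mul_assoc, ← neg_mul (2 * y), h3, h4]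
    ring
  calc _ = 𝔼 σ ∈ s.powerset, (y * ∑ j ∈ s, signOf σ j) ^ (2 * K) / (2 * K)! := by
        rw [mul_expect]
        refine expect_congr rfl fun σ _ => ?_
        rw [mul_pow, (even_two_mul K).pow_abs]
        ring
    _ ≤ 𝔼 σ ∈ s.powerset, (1 / 4) ^ K * Real.cosh (2 * (y * ∑ j ∈ s, signOf σ j)) :=
        expect_le_expect fun σ _ => h1 _
    _ = (1 / 4) ^ K * Real.cosh (2 * y) ^ #s := by rw [← mul_expect, h2]
    _ ≤ (1 / 4) ^ K * Real.exp ((2 * y) ^ 2 / 2) ^ #s := by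
        gcongr
        exact Real.cosh_le_exp_half_sq _
    _ = _ := by
        rw [← Real.exp_nat_mul]
        ring_nf

open Finset in
theorem norm_expect_cexp_sub_sum_le {ι : Type*} (I : Finset ι) (f : ι → ℝ) (y : ℝ) (K : ℕ) :
    ‖𝔼 i ∈ I, Complex.exp ((y * f i : ℝ) * Complex.I) -
        ∑ k ∈ range (2 * K), (y * Complex.I) ^ k / k ! * (𝔼 i ∈ I, f i ^ k : ℝ)‖ ≤
      |y| ^ (2 * K) / (2 * K)! * 𝔼 i ∈ I, f i ^ (2 * K) := by
  have h1 : ∑ k ∈ range (2 * K), (y * Complex.I) ^ k / k ! * (𝔼 i ∈ I, f i ^ k : ℝ) =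
      𝔼 i ∈ I, ∑ k ∈ range (2 * K), ((y * f i : ℝ) * Complex.I) ^ k / k ! := by
    rw [expect_sum_comm]
    refine sum_congr rfl fun k _ => ?_
    rw [Complex.ofReal_expect, mul_expect]
    refine expect_congr rfl fun i _ => ?_
    push_cast
    ring
  rw [h1, ← expect_sub_distrib, mul_expect]
  refine (RCLike.norm_expect_le (K := ℂ)).trans (expect_le_expect fun i _ => ?_)
  refine (norm_exp_mul_I_sub_sum_le _ _).trans_eq ?_
  rw [abs_mul, mul_pow, (even_two_mul K).pow_abs (f i)]
  ring

open Finset in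
/-- If all correlations of at most `2 * K` of the signs are at most `δ`, the characteristic
function of their sum is close to that of a sum of independent signs. -/
theorem norm_expect_cexp_sub_le {ι : Type*} {I : Finset ι} (hI : I.Nonempty) {s : Finset ℕ}
    {e : ι → ℕ → ℝ} (he : ∀ i ∈ I, ∀ j ∈ s, e i j ^ 2 = 1) {K : ℕ} {δ : ℝ} (hδ : 0 ≤ δ)
    (h : ∀ J ⊆ s, J.Nonempty → #J ≤ 2 * K → |𝔼 i ∈ I, ∏ j ∈ J, e i j| ≤ δ) (y : ℝ) :
    ‖𝔼 i ∈ I, Complex.exp ((y * ∑ j ∈ s, e i j : ℝ) * Complex.I) - (Real.cos y : ℂ) ^ #s‖ ≤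
      ∑ k ∈ range (2 * K + 1), |y| ^ k / k ! * ((#s : ℝ) ^ k * δ) +
        2 * ((1 / 4) ^ K * Real.exp (2 * (#s * y ^ 2))) := by
  have hN : ∀ k, 𝔼 σ ∈ s.powerset, (∑ j ∈ s, signOf σ j) ^ k =
      #((Fintype.piFinset fun _ : Fin k => s).filter fun t => oddSupport t = ∅) := by
    intro k
    have h1 := abs_expect_pow_sub_le (powerset_nonempty s) (s := s) (e := signOf) (k := k)
      (fun σ _ j _ => signOf_sq σ j) le_rfl fun J hJs hJ _ => by
        rw [expect_powerset_prod_signOf_eq_zero hJs hJ, abs_zero]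
    rw [mul_zero] at h1
    exact sub_eq_zero.1 (abs_nonpos_iff.1 h1)
  have hM : ∀ k ≤ 2 * K, |𝔼 i ∈ I, (∑ j ∈ s, e i j) ^ k -
      𝔼 σ ∈ s.powerset, (∑ j ∈ s, signOf σ j) ^ k| ≤ (#s : ℝ) ^ k * δ := by
    intro k hk
    rw [hN]
    exact abs_expect_pow_sub_le hI he hδ fun J hJs hJ hJk => h J hJs hJ (hJk.trans hk)
  have h1 := norm_expect_cexp_sub_sum_le I (fun i => ∑ j ∈ s, e i j) y K
  have h2 := norm_expect_cexp_sub_sum_le s.powerset (fun σ => ∑ j ∈ s, signOf σ j) y K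
  have h3 := expect_powerset_pow_le s y K
  rw [expect_powerset_cexp] at h2
  set P := ∑ k ∈ range (2 * K), (y * Complex.I) ^ k / k ! *
    (𝔼 i ∈ I, (∑ j ∈ s, e i j) ^ k : ℝ) with hP
  set Q := ∑ k ∈ range (2 * K), (y * Complex.I) ^ k / k ! *
    (𝔼 σ ∈ s.powerset, (∑ j ∈ s, signOf σ j) ^ k : ℝ) with hQ
  have h4 : ‖P - Q‖ ≤ ∑ k ∈ range (2 * K), |y| ^ k / k ! * ((#s : ℝ) ^ k * δ) := by
    rw [hP, hQ, ← sum_sub_distrib]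
    refine (norm_sum_le _ _).trans (sum_le_sum fun k hk => ?_)
    rw [← mul_sub, ← Complex.ofReal_sub, norm_mul, Complex.norm_real, Real.norm_eq_abs]
    refine mul_le_mul (le_of_eq ?_) (hM k (mem_range.1 hk).le) (abs_nonneg _) (by positivity)
    simp
  have h5 : |y| ^ (2 * K) / (2 * K)! * 𝔼 i ∈ I, (∑ j ∈ s, e i j) ^ (2 * K) ≤
      |y| ^ (2 * K) / (2 * K)! * 𝔼 σ ∈ s.powerset, (∑ j ∈ s, signOf σ j) ^ (2 * K) +
        |y| ^ (2 * K) / (2 * K)! * ((#s : ℝ) ^ (2 * K) * δ) := by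
    rw [← mul_add]
    gcongr
    linarith [(abs_le.1 (hM (2 * K) le_rfl)).2]
  rw [sum_range_succ]
  set z := 𝔼 i ∈ I, Complex.exp ((y * ∑ j ∈ s, e i j : ℝ) * Complex.I)
  set w := (Real.cos y : ℂ) ^ #s
  have h6 : ‖z - w‖ ≤ ‖z - P‖ + ‖P - Q‖ + ‖w - Q‖ := by
    rw [show z - w = (z - P) + (P - Q) - (w - Q) by ring]
    exact (norm_sub_le _ _).trans (by gcongr; exact norm_add_le _ _)
  linarith

open Finset ProbabilityTheory in
theorem exists_probabilityMeasure_charFun_eq_expect {ι : Type*} {I : Finset ι} (hI : I.Nonempty)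
    (f : ι → ℝ) :
    ∃ μ : ProbabilityMeasure ℝ,
      (∀ t, charFun (μ : Measure ℝ) t = 𝔼 i ∈ I, Complex.exp ((t * f i : ℝ) * Complex.I)) ∧
      ∀ lam, (μ (Set.Iic lam) : ℝ) = (#(I.filter fun i => f i ≤ lam) : ℝ) / #I := by
  have hc : (#I : ENNReal) ≠ 0 := Nat.cast_ne_zero.2 hI.card_ne_zero
  refine ⟨⟨∑ i ∈ I, (#I : ENNReal)⁻¹ • Measure.dirac (f i), ⟨?_⟩⟩, fun t => ?_, fun lam => ?_⟩
  · simp [ENNReal.mul_inv_cancel hc]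
  · rw [charFun_apply_real]
    simp only [ProbabilityMeasure.coe_mk]
    rw [integral_finsetSum_measure]
    · simp only [integral_smul_measure, integral_dirac, ← smul_sum]
      rw [expect_eq_sum_div_card]
      simp [div_eq_inv_mul]
    · intro i _
      refine Integrable.smul_measure ?_ (by simpa using hc)
      exact integrable_dirac (by simp)
  · rw [ProbabilityMeasure.mk_apply, Measure.coe_finsetSum, Finset.sum_apply]
    simp only [Measure.smul_apply, Measure.dirac_apply' _ measurableSet_Iic, smul_eq_mul, ← mul_sum]
    simp [Set.indicator_apply, sum_boole, div_eq_inv_mul]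

open ProbabilityTheory in
theorem gaussLimit_eq_gaussianReal (lam : ℝ) :
    gaussLimit lam = (gaussianReal 0 1).real (Set.Iic lam) := by
  rw [measureReal_def, gaussianReal_apply_eq_integral _ one_ne_zero, ENNReal.toReal_ofReal
    (integral_nonneg fun x => gaussianPDFReal_nonneg _ _ _), gaussLimit, ← integral_const_mul]
  congr 1 with x
  simp [gaussianPDFReal]

open Finset ProbabilityTheory in
theorem tendsto_card_filter_div_card {α ι : Type*} {l : Filter α} [l.IsCountablyGenerated]
    {I : α → Finset ι} (hI : ∀ a, (I a).Nonempty) {f : α → ι → ℝ}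
    (hf : ∀ t : ℝ, Tendsto (fun a => 𝔼 i ∈ I a, Complex.exp ((t * f a i : ℝ) * Complex.I)) l
      (𝓝 (Real.exp (-t ^ 2 / 2) : ℝ))) (lam : ℝ) :
    Tendsto (fun a => (#((I a).filter fun i => f a i ≤ lam) : ℝ) / #(I a)) l
      (𝓝 (gaussLimit lam)) := by
  choose μ hμ hμ' using fun a => exists_probabilityMeasure_charFun_eq_expect (hI a) (f a)
  simp_rw [← hμ', gaussLimit_eq_gaussianReal]
  set ν : ProbabilityMeasure ℝ := ⟨gaussianReal 0 1, inferInstance⟩ with hν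
  have h1 : Tendsto μ l (𝓝 ν) := by
    refine tendsto_of_seq_tendsto fun u hu => ProbabilityMeasure.tendsto_of_tendsto_charFun
      fun t => ?_
    have h2 : charFun (ν : Measure ℝ) t = (Real.exp (-t ^ 2 / 2) : ℝ) := by
      rw [hν, ProbabilityMeasure.coe_mk, charFun_gaussianReal]
      simp [neg_div]
    rw [h2]
    exact ((hf t).comp hu).congr fun n => (hμ _ t).symm
  have h3 := ProbabilityMeasure.tendsto_measure_of_null_frontier_of_tendsto h1
    (E := Set.Iic lam) (by
      have := nullSingletonClass_gaussianReal (μ := 0) (v := 1) one_ne_zero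
      simp [hν, measure_singleton])
  exact NNReal.tendsto_coe.2 h3

theorem tendsto_cos_div_sqrt_pow (t : ℝ) :
    Tendsto (fun n : ℕ => Real.cos (t / √n) ^ n) atTop (𝓝 (Real.exp (-t ^ 2 / 2))) := by
  have h1 : Tendsto (fun n : ℕ => (n : ℝ) * (Real.cos (t / √n) - 1)) atTop
      (𝓝 (-t ^ 2 / 2)) := by
    refine tendsto_iff_norm_sub_tendsto_zero.2 ?_
    have h2 : Tendsto (fun n : ℕ => t ^ 4 * (5 / 96) / n) atTop (𝓝 0) :=
      tendsto_const_div_atTop_nhds_zero_nat _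
    refine squeeze_zero' (Eventually.of_forall fun _ => norm_nonneg _) ?_ h2
    filter_upwards [eventually_ge_atTop 1, tendsto_natCast_atTop_atTop.eventually_ge_atTop (t ^ 2)]
      with n hn hnt
    have hn0 : (0 : ℝ) < n := by exact_mod_cast hn
    have hsq : (t / √n) ^ 2 = t ^ 2 / n := by rw [div_pow, Real.sq_sqrt hn0.le]
    have h3 : |t / √n| ≤ 1 := by
      rw [← sq_le_one_iff_abs_le_one, hsq]
      exact div_le_one_of_le₀ hnt hn0.le
    have h4 := Real.cos_bound h3
    have h5 : |t / √n| ^ 4 = t ^ 4 / n ^ 2 := by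
      rw [show (4 : ℕ) = 2 * 2 from rfl, pow_mul, sq_abs, hsq, div_pow, ← pow_mul]
    rw [h5, hsq] at h4
    have h6 : (n : ℝ) * (Real.cos (t / √n) - 1) - -t ^ 2 / 2 =
        n * (Real.cos (t / √n) - (1 - t ^ 2 / n / 2)) := by
      field_simp
      ring
    rw [h6, norm_mul, Real.norm_of_nonneg hn0.le, Real.norm_eq_abs]
    calc (n : ℝ) * _ ≤ n * (t ^ 4 / n ^ 2 * (5 / 96)) := by gcongr
      _ = _ := by field_simp
  simpa using Real.tendsto_one_add_pow_exp_of_tendsto h1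

open Finset in
theorem tendsto_expect_cexp {α ι : Type*} {l : Filter α} {I : α → Finset ι}
    (hI : ∀ a, (I a).Nonempty) {s : α → Finset ℕ} (hs : Tendsto (fun a => #(s a)) l atTop)
    {e : α → ι → ℕ → ℝ} (he : ∀ᶠ a in l, ∀ i ∈ I a, ∀ j ∈ s a, e a i j ^ 2 = 1) {δ : α → ℝ}
    (hδ0 : ∀ᶠ a in l, 0 ≤ δ a)
    (hδ : ∀ k : ℕ, Tendsto (fun a => (#(s a) : ℝ) ^ k * δ a) l (𝓝 0))
    (h : ∀ k, ∀ᶠ a in l, ∀ J ⊆ s a, J.Nonempty → #J ≤ k → |𝔼 i ∈ I a, ∏ j ∈ J, e a i j| ≤ δ a)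
    (t : ℝ) :
    Tendsto (fun a => 𝔼 i ∈ I a, Complex.exp
      ((t * ((∑ j ∈ s a, e a i j) / √(#(s a))) : ℝ) * Complex.I)) l
      (𝓝 (Real.exp (-t ^ 2 / 2) : ℝ)) := by
  have h1 : Tendsto (fun a => ((Real.cos (t / √(#(s a))) ^ #(s a) : ℝ) : ℂ)) l
      (𝓝 (Real.exp (-t ^ 2 / 2) : ℝ)) :=
    (Complex.continuous_ofReal.tendsto _).comp ((tendsto_cos_div_sqrt_pow t).comp hs)
  refine (tendsto_iff_of_dist ?_).1 h1
  rw [Metric.tendsto_nhds]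
  intro ε hε
  obtain ⟨K, hK⟩ : ∃ K : ℕ, 2 * ((1 / 4) ^ K * Real.exp (2 * t ^ 2)) < ε / 2 := by
    have h2 : Tendsto (fun K : ℕ => 2 * ((1 / 4 : ℝ) ^ K * Real.exp (2 * t ^ 2))) atTop
        (𝓝 (2 * (0 * Real.exp (2 * t ^ 2)))) :=
      ((tendsto_pow_atTop_nhds_zero_of_lt_one (by norm_num) (by norm_num)).mul_const _).const_mul _
    rw [zero_mul, mul_zero] at h2
    exact (h2.eventually_lt_const (half_pos hε)).exists
  have h3 : Tendsto (fun a => ∑ k ∈ range (2 * K + 1), |t| ^ k / k ! * ((#(s a) : ℝ) ^ k * δ a)) l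
      (𝓝 0) := by
    simpa using tendsto_finsetSum (range (2 * K + 1)) fun k _ => (hδ k).const_mul (|t| ^ k / k !)
  filter_upwards [he, hδ0, h (2 * K), h3.eventually_lt_const (half_pos hε),
    hs.eventually_ge_atTop 1] with a hea hδa ha h3a hsa
  have hs1 : (1 : ℝ) ≤ #(s a) := by exact_mod_cast hsa
  have hsq : 1 ≤ √(#(s a) : ℝ) := Real.one_le_sqrt.2 hs1
  have h4 := norm_expect_cexp_sub_le (hI a) hea hδa ha (t / √(#(s a)))
  rw [dist_zero_right, Real.norm_of_nonneg dist_nonneg, dist_comm, dist_eq_norm]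
  have h5 : ∀ x : ℝ, t * (x / √(#(s a))) = t / √(#(s a)) * x := fun x => by ring
  simp_rw [h5, Complex.ofReal_pow]
  refine h4.trans_lt ?_
  have h6 : #(s a) * (t / √(#(s a))) ^ 2 = t ^ 2 := by
    rw [div_pow, Real.sq_sqrt (by linarith)]
    field_simp
  rw [h6]
  have h7 : ∑ k ∈ range (2 * K + 1), |t / √(#(s a))| ^ k / k ! * ((#(s a) : ℝ) ^ k * δ a) ≤
      ∑ k ∈ range (2 * K + 1), |t| ^ k / k ! * ((#(s a) : ℝ) ^ k * δ a) := by
    have h8 : |t / √(#(s a))| ≤ |t| := by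
      rw [abs_div, abs_of_pos (by linarith : 0 < √(#(s a) : ℝ))]
      exact div_le_self (abs_nonneg _) hsq
    exact sum_le_sum fun k _ => mul_le_mul_of_nonneg_right
      (div_le_div_of_nonneg_right (pow_le_pow_left₀ (abs_nonneg _) h8 k) (by positivity))
      (by positivity)
  linarith

open Finset in
theorem M_eq_mul_card_div_card {g : ℝ → ℝ} {q h : ℕ} (hg : 1 ≤ g q) (hh : 1 ≤ h) (lam : ℝ) :
    M g q h lam = ⌊g q⌋₊ / g q * ((#((Icc 1 ⌊g q⌋₊).filter fun m : ℕ =>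
      (∑ j ∈ Icc 1 h, (jacobiSym ((m : ℤ) + j) q : ℝ)) / √(h : ℝ) ≤ lam) : ℝ) /
        #(Icc 1 ⌊g q⌋₊)) := by
  have hset : {m : ℤ | 1 ≤ (m : ℝ) ∧ (m : ℝ) ≤ g q ∧ (S h (m : ℝ) q : ℝ) ≤ lam * √h} =
      (((Icc 1 ⌊g q⌋₊).filter fun m : ℕ => (∑ j ∈ Icc 1 h, (jacobiSym ((m : ℤ) + j) q : ℝ)) /
        √(h : ℝ) ≤ lam).map Nat.castEmbedding : Finset ℤ) := by
    ext m
    simp only [Set.mem_ofPred_eq, coe_map, Set.mem_image, mem_coe, mem_filter, mem_Icc,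
      Nat.castEmbedding_apply]
    have hS : ∀ m : ℤ, (S h (m : ℝ) q : ℝ) ≤ lam * √h ↔
        (∑ j ∈ Icc 1 h, (jacobiSym (m + j) q : ℝ)) / √(h : ℝ) ≤ lam := by
      intro m
      rw [div_le_iff₀ (Real.sqrt_pos.2 (by exact_mod_cast hh)), S, Int.floor_intCast]
      push_cast
      rfl
    rw [hS]
    constructor
    · rintro ⟨h1, h2, h3⟩
      lift m to ℕ using by
        have : (1 : ℤ) ≤ m := by exact_mod_cast h1
        omega
      exact ⟨m, ⟨⟨by exact_mod_cast h1, Nat.le_floor (by exact_mod_cast h2)⟩, h3⟩, rfl⟩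
    · rintro ⟨n, ⟨⟨h1, h2⟩, h3⟩, rfl⟩
      exact ⟨by exact_mod_cast h1, by exact_mod_cast (Nat.le_floor_iff (by linarith)).1 h2, h3⟩
  have hG : (⌊g q⌋₊ : ℝ) ≠ 0 := by
    have := Nat.le_floor (n := 1) (by simpa using hg)
    positivity
  rw [M, hset, Set.ncard_coe_finset, card_map, Nat.card_Icc, Nat.add_sub_cancel]
  field_simp

theorem prod_jacobiSym_eq (J : Finset ℕ) (m q : ℕ) :
    ∏ j ∈ J, (jacobiSym ((m : ℤ) + j) q : ℝ) = jacobiSym (shiftProd J m : ℕ) q := by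
  unfold shiftProd
  induction J using Finset.induction_on with
  | empty => simp
  | insert a J ha ih =>
    rw [Finset.prod_insert ha, Finset.prod_insert ha, ih, Nat.cast_mul, jacobiSym.mul_left]
    push_cast
    rfl

open Finset in
theorem abs_expect_prod_jacobiSym_le {A c : ℝ} {h : ℕ → ℕ} {q : ℕ} {J : Finset ℕ} (hA : 0 ≤ A)
    (hq : 1 ≤ Real.log q) (hJ : J ⊆ Icc 1 (h q)) (hE : q ∉ exceptionalSet A c h #J) :
    |𝔼 m ∈ Icc 1 ⌊Real.log q ^ A⌋₊, ∏ j ∈ J, (jacobiSym ((m : ℤ) + j) q : ℝ)| ≤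
      2 * Real.log q ^ (-c) := by
  have h1 : |∑ m ∈ Icc 1 ⌊Real.log q ^ A⌋₊, (jacobiSym (shiftProd J m : ℕ) q : ℝ)| ≤
      Real.log q ^ (A - c) := by
    by_contra! h2
    exact hE ⟨J, hJ, rfl, h2⟩
  have hL : 0 < Real.log q := by linarith
  have h2 : 1 ≤ Real.log q ^ A := Real.one_le_rpow hq hA
  have h3 : Real.log q ^ A / 2 ≤ ⌊Real.log q ^ A⌋₊ := by
    have h4 : (1 : ℝ) ≤ ⌊Real.log q ^ A⌋₊ := by
      exact_mod_cast Nat.le_floor (n := 1) (by simpa using h2)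
    linarith [Nat.lt_floor_add_one (Real.log q ^ A)]
  simp_rw [prod_jacobiSym_eq]
  rw [expect_eq_sum_div_card, abs_div, Nat.card_Icc, Nat.add_sub_cancel, Nat.abs_cast]
  calc _ ≤ Real.log q ^ (A - c) / (Real.log q ^ A / 2) := by gcongr
    _ = _ := by
      rw [sub_eq_add_neg, Real.rpow_add hL]
      field_simp

theorem tendsto_natFloor_div_self_of_tendsto {α : Type*} {l : Filter α} {f : α → ℝ}
    (hf : Tendsto f l atTop) : Tendsto (fun a => (⌊f a⌋₊ : ℝ) / f a) l (𝓝 1) :=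
  (tendsto_nat_floor_div_atTop (R := ℝ)).comp hf

open Finset in
theorem tendsto_M_of_eventually_notMem {A c : ℝ} (hA : 1 < A) (hc : 0 < c) {h : ℕ → ℕ}
    (hinf : Tendsto h (atTop ⊓ 𝓟 {p : ℕ | p.Prime}) atTop)
    (hsmall : Tendsto (fun q : ℕ => Real.log (h q) / Real.log (Real.log q))
      (atTop ⊓ 𝓟 {p : ℕ | p.Prime}) (𝓝 0)) {B : Set ℕ} (hB : B ⊆ {p : ℕ | p.Prime})
    (hE : ∀ k, ∀ᶠ q in atTop ⊓ 𝓟 B, q ∉ exceptionalSet A c h (k + 1)) (lam : ℝ) :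
    Tendsto (fun q : ℕ => M (fun x : ℝ => Real.log x ^ A) q (h q) lam)
      (atTop ⊓ 𝓟 B) (𝓝 (gaussLimit lam)) := by
  set l := atTop ⊓ 𝓟 B with hl
  have hl' : l ≤ atTop ⊓ 𝓟 {p : ℕ | p.Prime} := inf_le_inf_left _ (principal_mono.2 hB)
  have hprime : ∀ᶠ q in l, q.Prime := hl' (mem_inf_of_right (mem_principal_self _))
  have hcast : Tendsto (fun q : ℕ => (q : ℝ)) l atTop :=
    tendsto_natCast_atTop_atTop.mono_left inf_le_left
  have hlog : Tendsto (fun q : ℕ => Real.log q) l atTop := Real.tendsto_log_atTop.comp hcast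
  have hpow : Tendsto (fun q : ℕ => Real.log q ^ A) l atTop :=
    (tendsto_rpow_atTop (by linarith)).comp hlog
  have hh := hinf.mono_left hl'
  have hτ : ∀ τ > (0 : ℝ), ∀ᶠ q in l, (h q : ℝ) ≤ Real.log q ^ τ := by
    intro τ hτ
    obtain ⟨X, hX⟩ := (eventually_le_rpow_of_log_div_log_log hsmall hτ).exists
    filter_upwards [hprime, hcast.eventually_ge_atTop X] with q hq hXq using hX q hq hXq
  have hsmallG : ∀ᶠ q : ℕ in l, Real.log q ^ A + Real.log q ^ (1 : ℝ) < q := by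
    have h1 : ∀ r : ℝ, ∀ᶠ q : ℕ in l, Real.log q ^ r ≤ 1 / 3 * q := fun r => by
      filter_upwards [hcast.eventually ((isLittleO_log_rpow_rpow_atTop r one_pos).bound
        (c := 1 / 3) (by norm_num)), hcast.eventually_ge_atTop 1] with q hq hq1
      have := Real.log_nonneg hq1
      rwa [Real.norm_of_nonneg (by positivity), Real.norm_of_nonneg (by positivity),
        Real.rpow_one] at hq
    filter_upwards [h1 A, h1 1, hcast.eventually_gt_atTop 0] with q h2 h3 h4
    linarith
  set I : ℕ → Finset ℕ := fun q => Icc 1 (max 1 ⌊Real.log q ^ A⌋₊) with hI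
  have hIG : ∀ q : ℕ, 1 ≤ Real.log q → I q = Icc 1 ⌊Real.log q ^ A⌋₊ := fun q hq => by
    rw [hI]
    simp only
    rw [max_eq_right]
    exact Nat.le_floor (by simpa using Real.one_le_rpow hq (by linarith : 0 ≤ A))
  have hchar := tendsto_expect_cexp (l := l) (I := I) (s := fun q => Icc 1 (h q))
    (e := fun q m j => (jacobiSym ((m : ℤ) + j) q : ℝ)) (δ := fun q => 2 * Real.log q ^ (-c))
    (fun q => nonempty_Icc.2 (le_max_left _ _)) (by simpa using hh) ?_ ?_ ?_ ?_
  · have hcdf := tendsto_card_filter_div_card (I := I)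
      (fun q => nonempty_Icc.2 (le_max_left _ _)) hchar lam
    have hlim := (tendsto_natFloor_div_self_of_tendsto hpow).mul hcdf
    rw [one_mul] at hlim
    refine hlim.congr' ?_
    filter_upwards [hlog.eventually_ge_atTop 1, hh.eventually_ge_atTop 1] with q hq hhq
    rw [M_eq_mul_card_div_card (g := fun x : ℝ => Real.log x ^ A)
      (Real.one_le_rpow hq (by linarith)) hhq, hIG q hq, Nat.card_Icc 1 (h q), Nat.add_sub_cancel]
  · filter_upwards [hprime, hlog.eventually_ge_atTop 1, hτ 1 one_pos, hsmallG]
      with q hq hq1 hhq hGq m hm j hj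
    rw [hIG q hq1, mem_Icc] at hm
    rw [mem_Icc] at hj
    have h1 : (m : ℝ) ≤ Real.log q ^ A := (Nat.le_floor_iff' (by omega)).1 hm.2
    have h2 : (j : ℝ) ≤ h q := by exact_mod_cast hj.2
    have h3 : m + j < q := by
      have : ((m + j : ℕ) : ℝ) < q := by push_cast; linarith
      exact_mod_cast this
    have h4 : Int.gcd ((m : ℤ) + j) q = 1 := by
      rw [← Nat.cast_add, Int.gcd_natCast_natCast]
      exact (Nat.coprime_of_lt_prime (by omega) h3 hq).symm
    exact_mod_cast jacobiSym.sq_one h4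
  · filter_upwards [hlog.eventually_ge_atTop 0] with q hq
    positivity
  · intro k
    set τ := c / (2 * (k + 1)) with hτdef
    have hτ0 : 0 < τ := by positivity
    have h1 : Tendsto (fun q : ℕ => 2 * Real.log q ^ (-(c / 2))) l (𝓝 0) := by
      simpa using ((tendsto_rpow_neg_atTop (half_pos hc)).comp hlog).const_mul 2
    refine squeeze_zero' ?_ ?_ h1
    · filter_upwards [hlog.eventually_ge_atTop 0] with q hq
      positivity
    · filter_upwards [hlog.eventually_ge_atTop 1, hτ τ hτ0] with q hq hhq
      rw [Nat.card_Icc, Nat.add_sub_cancel]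
      have hL : 0 < Real.log q := by linarith
      have hkτ : τ * k - c ≤ -(c / 2) := by
        rw [hτdef]
        have : c / (2 * (k + 1)) * k ≤ c / 2 := by
          rw [div_mul_eq_mul_div, div_le_div_iff₀ (by positivity) (by positivity)]
          nlinarith
        linarith
      calc (h q : ℝ) ^ k * (2 * Real.log q ^ (-c)) ≤
          (Real.log q ^ τ) ^ k * (2 * Real.log q ^ (-c)) := by gcongr
        _ = 2 * Real.log q ^ (τ * k - c) := by
          rw [← Real.rpow_natCast, ← Real.rpow_mul hL.le, sub_eq_add_neg, Real.rpow_add hL]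
          ring
        _ ≤ _ := by gcongr
  · intro k
    filter_upwards [(eventually_all_finset (range k)).2 fun i _ => hE i,
      hlog.eventually_ge_atTop 1] with q hqE hq J hJ hJ0 hJk
    rw [hIG q hq]
    refine abs_expect_prod_jacobiSym_le (by linarith) hq hJ ?_
    have h1 := hJ0.card_pos
    have h2 := hqE (#J - 1) (mem_range.2 (by omega))
    rwa [Nat.sub_add_cancel h1] at h2

theorem stmt16 (η : ℝ) (hη : η ∈ Set.Ioc (1 / 2 : ℝ) 1) (A : ℝ) (hA : 1 < A)
    (h : ℕ → ℕ)
    (hinf : Tendsto h (atTop ⊓ 𝓟 {p : ℕ | p.Prime}) atTop)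
    (hsmall : Tendsto (fun q : ℕ => Real.log (h q) / Real.log (Real.log q))
      (atTop ⊓ 𝓟 {p : ℕ | p.Prime}) (𝓝 0)) :
    ∃ B : Set ℕ, B ⊆ {p : ℕ | p.Prime} ∧ EtaStrong η B ∧
      ∀ lam : ℝ,
        Tendsto (fun q : ℕ => M (fun x : ℝ => Real.log x ^ A) q (h q) lam)
          (atTop ⊓ 𝓟 B) (𝓝 (gaussLimit lam)) := by
  have hρ : 0 < (A - 1) / 8 := by linarith
  have hc : 0 < min ((A - 1) / 8) (1 / 2) := lt_min hρ (by norm_num)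
  obtain ⟨B, hB, hBη, hBE⟩ := exists_etaStrong_eventually_notMem hη.2 hρ
    (fun k => exceptionalSet A (min ((A - 1) / 8) (1 / 2)) h (k + 1)) fun k ε hε =>
      eventually_ncard_exceptionalSet_le hA (by linarith [hη.1]) hη.2 hsmall k.succ_pos hρ
        (by linarith) (min_le_left _ _) ((min_le_right _ _).trans_lt (by norm_num)) hε
  exact ⟨B, hB, hBη, tendsto_M_of_eventually_notMem hA hc hinf hsmall hB hBE⟩
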